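/- arXiv:1703.09636 — 4 statements merged into one kernel-verified Lean document; each statement's English description precedes it below -/
import Mathlib

section
/- Let n be a squarefree positive integer, let Γ be a cyclic group of order n, and let G be any group of order n. Set z = |Z(G)| (the order of the centre of G), g = |G'| (the order of the commutator subgroup of G), and d = n/(g·z). Then the number of subgroups N of the symmetric group Perm(Γ) on the underlying set of Γ such that N is isomorphic to G, N acts regularly on Γ, and N is normalized by the subgroup λ(Γ) of left translations, equals 2^{ω(g)} · φ(d), where φ is Euler's totient function and ω(g) is the number of distinct prime factors of g. (By Greither–Pareigis theory, this number is the number of Hopf–Galois structures of type G on a cyclic Galois field extension of degree n.) -/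
/-- A subgroup `N ≤ Perm Γ` is regular: its action on `Γ` is transitive and
the stabiliser of every point is trivial. -/
def IsRegularSubgroup (Γ : Type*) [Group Γ] (N : Subgroup (Equiv.Perm Γ)) : Prop :=
  (∀ x y : Γ, ∃ ν ∈ N, ν x = y) ∧ ∀ ν ∈ N, ∀ x : Γ, ν x = x → ν = 1

/-- A subgroup `N ≤ Perm Γ` is normalised by the subgroup `λ(Γ)` of left translations. -/
def IsNormalizedByLeftTranslations (Γ : Type*) [Group Γ] (N : Subgroup (Equiv.Perm Γ)) : Prop :=
  ∀ γ : Γ, ∀ ν ∈ N, Equiv.mulLeft γ * ν * (Equiv.mulLeft γ)⁻¹ ∈ N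


/-- The product of the prime fields `ZMod p`, `p ∣ g`. -/
abbrev PR (g : ℕ) : Type := (p : g.primeFactors) → ZMod p.1

instance instFactPR (g : ℕ) (p : g.primeFactors) : Fact p.1.Prime :=
  ⟨Nat.prime_of_mem_primeFactors p.2⟩

lemma PR_card (g : ℕ) (hg : Squarefree g) : Nat.card (PR g) = g := by
  rw [Nat.card_pi]
  simp only [Nat.card_zmod]
  rw [Finset.prod_coe_sort g.primeFactors (fun p => p)]
  exact Nat.prod_primeFactors_of_squarefree hg

lemma dvd_of_primes {g k : ℕ} (hg : Squarefree g) (h : ∀ p ∈ g.primeFactors, p ∣ k) : g ∣ k := by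
  rw [← Nat.prod_primeFactors_of_squarefree hg]
  exact Finset.prod_primes_dvd k (fun p hp => (Nat.prime_of_mem_primeFactors hp).prime) h

lemma PR_cast_surj {g m : ℕ} (hg : Squarefree g) (hm : m ≠ 0) (hgm : g.Coprime m)
    (x : PR g) (y : ZMod m) : ∃ i : ℕ, (i : PR g) = x ∧ (i : ZMod m) = y := by
  have : NeZero m := ⟨hm⟩
  have hg0 : g ≠ 0 := hg.ne_zero
  let f : Fin (g * m) → PR g × ZMod m := fun i => ((i.1 : PR g), (i.1 : ZMod m))
  have hinj : Function.Injective f := by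
    intro i j hij
    have h1 : (i.1 : PR g) = (j.1 : PR g) := congrArg Prod.fst hij
    have h2 : (i.1 : ZMod m) = (j.1 : ZMod m) := congrArg Prod.snd hij
    rw [ZMod.natCast_eq_natCast_iff] at h2
    have h3 : i.1 ≡ j.1 [MOD g] := by
      rw [Nat.modEq_iff_dvd]
      refine Int.dvd_natAbs.1 (Int.natCast_dvd_natCast.2 (dvd_of_primes hg fun p hp => ?_))
      have := congrFun h1 ⟨p, hp⟩
      simp only [Pi.natCast_apply] at this
      rw [ZMod.natCast_eq_natCast_iff, Nat.modEq_iff_dvd] at this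
      exact Int.natCast_dvd_natCast.1 (Int.dvd_natAbs.2 this)
    have h4 := (Nat.modEq_and_modEq_iff_modEq_mul hgm).1 ⟨h3, h2⟩
    exact Fin.ext (Nat.ModEq.eq_of_lt_of_lt h4 i.2 j.2)
  have hbij : Function.Bijective f := by
    rw [Fintype.bijective_iff_injective_and_card]
    refine ⟨hinj, ?_⟩
    rw [Fintype.card_fin, Fintype.card_prod, ← Nat.card_eq_fintype_card (α := PR g), PR_card g hg,
      ZMod.card]
  obtain ⟨i, hi⟩ := hbij.2 (x, y)
  exact ⟨i.1, congrArg Prod.fst hi, congrArg Prod.snd hi⟩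

/-- Model of a metacyclic group. -/
@[ext] structure Mdl {R T : Type} [CommRing R] [CommRing T] (K : AddChar T R) : Type where
  fst : R
  snd : T

namespace Mdl
variable {R T : Type} [CommRing R] [CommRing T] {K : AddChar T R}

instance : Mul (Mdl K) := ⟨fun a b => ⟨a.fst + K a.snd * b.fst, a.snd + b.snd⟩⟩
instance : One (Mdl K) := ⟨⟨0, 0⟩⟩
instance : Inv (Mdl K) := ⟨fun a => ⟨-(K (-a.snd) * a.fst), -a.snd⟩⟩

@[simp] lemma mul_fst (a b : Mdl K) : (a * b).fst = a.fst + K a.snd * b.fst := rfl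
@[simp] lemma mul_snd (a b : Mdl K) : (a * b).snd = a.snd + b.snd := rfl
@[simp] lemma one_fst : (1 : Mdl K).fst = 0 := rfl
@[simp] lemma one_snd : (1 : Mdl K).snd = 0 := rfl
@[simp] lemma inv_fst (a : Mdl K) : (a⁻¹).fst = -(K (-a.snd) * a.fst) := rfl
@[simp] lemma inv_snd (a : Mdl K) : (a⁻¹).snd = -a.snd := rfl

instance : Group (Mdl K) :=
  Group.ofLeftAxioms
    (by intro a b c; ext <;> simp [AddChar.map_add_eq_mul] <;> ring)
    (by intro a; ext <;> simp)
    (by intro a; ext <;> simp)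

/-- the explicit automorphism -/
def mkAut (s : Rˣ) (t : R) (w : Tˣ) (h : ∀ y, K (w * y) = K y) : MulAut (Mdl K) where
  toFun a := ⟨s * a.fst + t * (K a.snd - 1), w * a.snd⟩
  invFun a := ⟨(s⁻¹ : Rˣ) * (a.fst - t * (K a.snd - 1)), (w⁻¹ : Tˣ) * a.snd⟩
  left_inv a := by
    ext
    · simp [h]
    · simp
  right_inv a := by
    ext
    · have := h ((w⁻¹ : Tˣ) * a.snd)
      simp at this
      simp [← this]
    · simp
  map_mul' a b := by
    ext
    · simp [h, AddChar.map_add_eq_mul]; ring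
    · simp; ring

@[simp] lemma mkAut_apply (s : Rˣ) (t : R) (w : Tˣ) (h : ∀ y, K (w * y) = K y) (a : Mdl K) :
    mkAut s t w h a = ⟨s * a.fst + t * (K a.snd - 1), w * a.snd⟩ := rfl

lemma pow_fst (x : R) (i : ℕ) : (⟨x, 0⟩ : Mdl K) ^ i = ⟨i * x, 0⟩ := by
  induction i with
  | zero => ext <;> simp
  | succ i ih => rw [pow_succ, ih]; ext <;> simp; ring

lemma pow_snd (a : Mdl K) (i : ℕ) : (a ^ i).snd = i * a.snd := by
  induction i with
  | zero => simp
  | succ i ih => rw [pow_succ, mul_snd, ih]; push_cast; ring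

lemma aut_structure (hc : ∀ (x : R) (y : T), ∃ i : ℕ, (i : R) = x ∧ (i : T) = y)
    (α : MulAut (Mdl K)) : ∃ (s : R) (w : T) (θ : T → R),
      ∀ x y, α ⟨x, y⟩ = ⟨s * x + θ y, w * y⟩ := by
  have h0 : ∀ x, (α ⟨x, 0⟩).snd = 0 := by
    intro x
    obtain ⟨i, hi, hi'⟩ := hc 0 1
    have h1 : (⟨x, 0⟩ : Mdl K) ^ i = 1 := by rw [pow_fst, hi]; ext <;> simp
    have h2 := congrArg (fun a => (α a).snd) h1
    simpa [map_pow, pow_snd, hi'] using h2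
  have h1 : ∀ x, α ⟨x, 0⟩ = ⟨(α ⟨1, 0⟩).fst * x, 0⟩ := by
    intro x
    obtain ⟨i, hi, -⟩ := hc x 0
    have e1 : (⟨x, 0⟩ : Mdl K) = ⟨1, 0⟩ ^ i := by rw [pow_fst, hi]; simp
    have e2 : α ⟨1, 0⟩ = ⟨(α ⟨1, 0⟩).fst, 0⟩ := Mdl.ext rfl (h0 1)
    rw [e1, map_pow]
    rw [e2, pow_fst, hi, mul_comm]
  have h2 : ∀ y, (α ⟨0, y⟩).snd = (α ⟨0, 1⟩).snd * y := by
    intro y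
    obtain ⟨i, hi, hi'⟩ := hc 0 y
    have e1 : ((⟨0, 1⟩ : Mdl K) ^ i).snd = y := by rw [pow_snd, hi']; simp
    have e2 : (⟨0, y⟩ : Mdl K) = ⟨-((⟨0, 1⟩ : Mdl K) ^ i).fst, 0⟩ * ⟨0, 1⟩ ^ i := by
      ext
      · simp
      · simp [e1]
    rw [e2, map_mul, mul_snd, h0, map_pow, pow_snd, hi', zero_add, mul_comm]
  refine ⟨(α ⟨1, 0⟩).fst, (α ⟨0, 1⟩).snd, fun y => (α ⟨0, y⟩).fst, fun x y => ?_⟩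
  have e : (⟨x, y⟩ : Mdl K) = ⟨x, 0⟩ * ⟨0, y⟩ := by ext <;> simp
  rw [e, map_mul, h1]
  apply Mdl.ext
  · rw [mul_fst, AddChar.map_zero_eq_one, one_mul]
  · rw [mul_snd, zero_add, h2]

lemma exists_mkAut (hc : ∀ (x : R) (y : T), ∃ i : ℕ, (i : R) = x ∧ (i : T) = y)
    (hK : IsUnit (K 1 - 1)) (α : MulAut (Mdl K)) :
    ∃ s t w h, α = mkAut s t w h := by
  obtain ⟨s, w, θ, hα⟩ := aut_structure hc α
  obtain ⟨s', w', θ', hα'⟩ := aut_structure hc α⁻¹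
  have hθ0 : θ 0 = 0 := by
    have := map_one α
    have e : (1 : Mdl K) = ⟨0, 0⟩ := rfl
    rw [e, hα] at this
    simpa using congrArg Mdl.fst this
  have hcomp : ∀ a, α (α⁻¹ a) = a := fun a => MulAut.apply_inv_self _ α a
  have hs : s * s' = 1 := by
    have a1 := hcomp ⟨1, 0⟩
    have a2 := hcomp ⟨0, 0⟩
    rw [hα', hα] at a1 a2
    have b1 := congrArg Mdl.fst a1
    have b2 := congrArg Mdl.fst a2
    simp at b1 b2
    linear_combination b1 - b2
  have hw : w * w' = 1 := by
    have a1 := hcomp ⟨0, 1⟩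
    rw [hα', hα] at a1
    have b1 := congrArg Mdl.snd a1
    simpa using b1
  have hmul : ∀ a b, α (a * b) = α a * α b := map_mul α
  have hθ : ∀ y y', θ (y + y') = θ y + K (w * y) * θ y' := by
    intro y y'
    have := congrArg Mdl.fst (hmul ⟨0, y⟩ ⟨0, y'⟩)
    have e : (⟨0, y⟩ * ⟨0, y'⟩ : Mdl K) = ⟨0, y + y'⟩ := by ext <;> simp
    rw [e, hα, hα, hα] at this
    simpa using this
  have hKw : ∀ y, K (w * y) = K y := by
    intro y
    have := congrArg Mdl.fst (hmul ⟨0, y⟩ ⟨1, 0⟩)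
    have e : (⟨0, y⟩ * ⟨1, 0⟩ : Mdl K) = ⟨K y, y⟩ := by ext <;> simp
    rw [e, hα, hα, hα] at this
    simp [hθ0] at this
    linear_combination (-s') * this + (K y - K (w * y)) * hs
  obtain ⟨κ, hκ⟩ := hK
  refine ⟨⟨s, s', hs, by rw [mul_comm, hs]⟩, (κ⁻¹ : Rˣ) * θ 1, ⟨w, w', hw, by rw [mul_comm, hw]⟩,
    hKw, ?_⟩
  ext1 ⟨x, y⟩
  rw [hα]
  ext
  · simp
    have a1 := hθ 1 y
    have a2 := hθ y 1
    rw [hKw] at a1 a2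
    rw [add_comm, a2] at a1
    have h3 : (κ : R) * θ y = θ 1 * (K y - 1) := by
      rw [hκ]; linear_combination -a1
    have h4 : θ y = (κ⁻¹ : Rˣ) * ((κ : R) * θ y) := by simp
    rw [h4, h3]; ring
  · simp

lemma mkAut_inj (hK : IsUnit (K 1 - 1)) {s s' : Rˣ} {t t' : R} {w w' : Tˣ} {h h'}
    (he : (mkAut s t w h : MulAut (Mdl K)) = mkAut s' t' w' h') : s = s' ∧ t = t' ∧ w = w' := by
  have h1 := congrArg Mdl.fst (congrFun (congrArg (fun a : MulAut (Mdl K) => (a : Mdl K → Mdl K)) he) ⟨1, 0⟩)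
  have h2 := (congrFun (congrArg (fun a : MulAut (Mdl K) => (a : Mdl K → Mdl K)) he) ⟨0, 1⟩)
  have h3 := congrArg Mdl.fst h2
  have h4 := congrArg Mdl.snd h2
  simp at h1 h3 h4
  exact ⟨Units.ext h1, hK.mul_left_injective h3, Units.ext h4⟩

lemma card_aut (hc : ∀ (x : R) (y : T), ∃ i : ℕ, (i : R) = x ∧ (i : T) = y)
    (hK : IsUnit (K 1 - 1)) : Nat.card (MulAut (Mdl K)) =
      Nat.card Rˣ * (Nat.card R * Nat.card {w : Tˣ // ∀ y, K (w * y) = K y}) := by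
  rw [← Nat.card_prod, ← Nat.card_prod]
  refine (Nat.card_congr (Equiv.ofBijective
    (fun q : Rˣ × R × {w : Tˣ // ∀ y, K (w * y) = K y} =>
      (mkAut q.1 q.2.1 q.2.2.1 q.2.2.2 : MulAut (Mdl K))) ⟨?_, ?_⟩)).symm
  · rintro ⟨s, t, w, h⟩ ⟨s', t', w', h'⟩ he
    obtain ⟨rfl, rfl, rfl⟩ := mkAut_inj hK he
    rfl
  · intro α
    obtain ⟨s, t, w, h, rfl⟩ := exists_mkAut hc hK α
    exact ⟨(s, t, ⟨w, h⟩), rfl⟩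

end Mdl

/-- The affine map `x ↦ α x * a`. -/
def aff {M : Type} [Group M] (α : MulAut M) (a : M) : M → M := fun x => α x * a

/-- The orbit of `1` under the affine map is everything. -/
def FullOrbit {M : Type} [Group M] (α : MulAut M) (a : M) : Prop :=
  ∀ x : M, ∃ i : ℕ, (aff α a)^[i] 1 = x

/-- Normalised regular embeddings. -/
def GoodHom (Γ M : Type) [Group Γ] [Group M] : Type :=
  {h : M →* Equiv.Perm Γ // Function.Bijective (fun x => h x 1) ∧
    ∀ (γ : Γ) (x : M), ∃ y, Equiv.mulLeft γ * h x * (Equiv.mulLeft γ)⁻¹ = h y}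

lemma GoodHom.inj {Γ M : Type} [Group Γ] [Group M] (h : GoodHom Γ M) :
    Function.Injective h.1 := by
  intro x y hxy
  apply h.2.1.1
  simp only [hxy]

lemma GoodHom.range_good {Γ M : Type} [Group Γ] [Group M] (h : GoodHom Γ M) :
    Nonempty (h.1.range ≃* M) ∧ IsRegularSubgroup Γ h.1.range ∧
      IsNormalizedByLeftTranslations Γ h.1.range := by
  refine ⟨⟨(MonoidHom.ofInjective h.inj).symm⟩, ⟨?_, ?_⟩, ?_⟩
  · intro x y
    obtain ⟨a, ha⟩ := h.2.1.2 x
    obtain ⟨b, hb⟩ := h.2.1.2 y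
    refine ⟨h.1 (b * a⁻¹), ⟨_, rfl⟩, ?_⟩
    simp only at ha hb
    rw [← ha, ← hb, ← Equiv.Perm.mul_apply, ← map_mul]
    simp
  · rintro _ ⟨b, rfl⟩ x hx
    obtain ⟨a, ha⟩ := h.2.1.2 x
    simp only at ha
    rw [← ha, ← Equiv.Perm.mul_apply, ← map_mul] at hx
    have := h.2.1.1 hx
    have hb : b = 1 := by simpa using this
    rw [hb, map_one]
  · rintro γ _ ⟨b, rfl⟩
    obtain ⟨y, hy⟩ := h.2.2 γ b
    exact ⟨y, hy.symm⟩

/-- Assemble a good hom from a good subgroup and an isomorphism. -/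
def GoodHom.mk' {Γ M : Type} [Group Γ] [Group M] (N : Subgroup (Equiv.Perm Γ))
    (h1 : IsRegularSubgroup Γ N) (h2 : IsNormalizedByLeftTranslations Γ N) (e : M ≃* N) :
    GoodHom Γ M :=
  ⟨N.subtype.comp e.toMonoidHom, by
    constructor
    · constructor
      · intro x y hxy
        have hxy' : (e x : Equiv.Perm Γ) 1 = (e y : Equiv.Perm Γ) 1 := hxy
        have h3 : ((e y)⁻¹ * e x : N).1 1 = 1 := by
          simp [hxy']
        have h4 := h1.2 _ ((e y)⁻¹ * e x : N).2 _ h3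
        have h5 : (e y)⁻¹ * e x = 1 := Subtype.ext h4
        exact e.injective (inv_mul_eq_one.1 h5).symm
      · intro y
        obtain ⟨ν, hν, h⟩ := h1.1 1 y
        refine ⟨e.symm ⟨ν, hν⟩, ?_⟩
        simp [h]
    · intro γ x
      refine ⟨e.symm ⟨_, h2 γ _ (e x).2⟩, ?_⟩
      simp⟩

lemma card_goodHom (Γ M : Type) [Group Γ] [Group M] [Finite Γ] [Finite M] :
    Nat.card (GoodHom Γ M) = Nat.card {N : Subgroup (Equiv.Perm Γ) //
        Nonempty (N ≃* M) ∧ IsRegularSubgroup Γ N ∧ IsNormalizedByLeftTranslations Γ N} *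
      Nat.card (MulAut M) := by
  rw [← Nat.card_prod]
  refine (Nat.card_congr (Equiv.ofBijective
    (fun q : {N : Subgroup (Equiv.Perm Γ) //
        Nonempty (N ≃* M) ∧ IsRegularSubgroup Γ N ∧ IsNormalizedByLeftTranslations Γ N} ×
        MulAut M => (GoodHom.mk' q.1.1 q.1.2.2.1 q.1.2.2.2
          (MulEquiv.trans q.2 q.1.2.1.some.symm) : GoodHom Γ M)) ⟨?_, ?_⟩)).symm
  · rintro ⟨⟨N, hN⟩, α⟩ ⟨⟨N', hN'⟩, α'⟩ he
    have he1 := congrArg (fun q : GoodHom Γ M => q.1.range) he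
    have hr : ∀ (N : Subgroup (Equiv.Perm Γ)) (e : M ≃* N),
        (N.subtype.comp e.toMonoidHom).range = N := by
      intro N e
      ext ν
      constructor
      · rintro ⟨x, rfl⟩
        exact (e x).2
      · intro hν
        exact ⟨e.symm ⟨ν, hν⟩, by simp⟩
    simp only [GoodHom.mk', hr] at he1
    subst he1
    congr 1
    ext x
    have := DFunLike.congr_fun (congrArg (fun q : GoodHom Γ M => q.1) he) x
    simp only [GoodHom.mk'] at this
    have h2 := Subtype.ext this
    simpa using h2
  · intro h
    refine ⟨(⟨h.1.range, h.range_good⟩,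
      (MonoidHom.ofInjective h.inj).trans h.range_good.1.some), ?_⟩
    apply Subtype.ext
    ext x
    simp only [GoodHom.mk', MonoidHom.comp_apply, Subgroup.coe_subtype]
    change (((h.range_good.1.some.symm (h.range_good.1.some (MonoidHom.ofInjective h.inj x))) :
      Equiv.Perm Γ)) _ = _
    rw [MulEquiv.symm_apply_apply]
    rfl

section cyc
variable {Γ M : Type} [Group Γ] [Group M]

lemma GoodHom.exists_aff (h : GoodHom Γ M) (σ : Γ) :
    ∃ q : MulAut M × M, ∀ x, h.1 (aff q.1 q.2 x) 1 = σ * h.1 x 1 := by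
  choose c hc using h.2.2
  obtain ⟨a, ha⟩ := h.2.1.2 σ
  have hmul : ∀ γ x y, c γ (x * y) = c γ x * c γ y := by
    intro γ x y
    apply h.inj
    rw [← hc, map_mul, map_mul, ← hc, ← hc]
    group
  have hinv : ∀ γ γ' x, γ * γ' = 1 → c γ (c γ' x) = x := by
    intro γ γ' x hg
    apply h.inj
    rw [← hc, ← hc]
    have : Equiv.mulLeft γ * Equiv.mulLeft γ' = 1 := by
      ext z
      simp [← mul_assoc, hg]
    have h2 : Equiv.mulLeft γ' = (Equiv.mulLeft γ)⁻¹ := eq_inv_of_mul_eq_one_right this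
    rw [h2]
    group
  let α : MulAut M :=
    { toFun := c σ
      invFun := c σ⁻¹
      left_inv := fun x => hinv _ _ x (by simp)
      right_inv := fun x => hinv _ _ x (by simp)
      map_mul' := hmul σ }
  refine ⟨(α, a), fun x => ?_⟩
  have h1 : h.1 (aff α a x) = h.1 (c σ x) * h.1 a := map_mul _ _ _
  simp only at ha
  rw [h1, Equiv.Perm.mul_apply, ha, ← hc]
  simp

lemma GoodHom.iter (h : GoodHom Γ M) (σ : Γ) (q : MulAut M × M)
    (hq : ∀ x, h.1 (aff q.1 q.2 x) 1 = σ * h.1 x 1) (i : ℕ) :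
    h.1 ((aff q.1 q.2)^[i] 1) 1 = σ ^ i := by
  induction i with
  | zero => simp
  | succ i ih => rw [Function.iterate_succ_apply', hq, ih, pow_succ']

lemma aff_inj {q q' : MulAut M × M} (h : ∀ x, aff q.1 q.2 x = aff q'.1 q'.2 x) : q = q' := by
  have h1 : q.2 = q'.2 := by simpa [aff] using h 1
  refine Prod.ext ?_ h1
  ext x
  have := h x
  simpa [aff, h1] using this

lemma card_goodHom' [Finite Γ] [Finite M] [IsCyclic Γ] (hcard : Nat.card Γ = Nat.card M) :
    Nat.card (GoodHom Γ M) = Nat.card {q : MulAut M × M // FullOrbit q.1 q.2} := by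
  obtain ⟨σ, hσ⟩ := IsCyclic.exists_generator (α := Γ)
  have hσ' : ∀ γ : Γ, ∃ i : ℕ, σ ^ i = γ := by
    intro γ
    have := hσ γ
    rw [← mem_powers_iff_mem_zpowers] at this
    exact this
  choose F hF using fun h : GoodHom Γ M => h.exists_aff σ
  have hFt : ∀ h, FullOrbit (F h).1 (F h).2 := by
    intro h x
    obtain ⟨i, hi⟩ := hσ' (h.1 x 1)
    exact ⟨i, h.2.1.1 ((h.iter σ _ (hF h) i).trans hi)⟩
  refine Nat.card_congr (Equiv.ofBijective (fun h => ⟨F h, hFt h⟩) ⟨?_, ?_⟩)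
  · intro h h' he
    have he : F h = F h' := congrArg Subtype.val he
    have hb : ∀ x, h.1 x 1 = h'.1 x 1 := by
      intro x
      obtain ⟨i, hi⟩ := hFt h x
      rw [← hi, h.iter σ _ (hF h), he, h'.iter σ _ (hF h')]
    apply Subtype.ext
    ext x γ
    obtain ⟨y, hy⟩ := h.2.1.2 γ
    simp only at hy
    have hy' := hy
    rw [hb] at hy'
    conv_lhs => rw [← hy]
    conv_rhs => rw [← hy']
    rw [← Equiv.Perm.mul_apply, ← Equiv.Perm.mul_apply, ← map_mul, ← map_mul, hb]
  · rintro ⟨⟨α, a⟩, ht⟩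
    -- the bijection `Γ ≃ M`
    let f : Equiv.Perm M := α.toEquiv.trans (Equiv.mulRight a)
    have hf : ∀ x, f x = aff α a x := fun x => rfl
    have hff : ∀ i : ℕ, f^[i] 1 = (aff α a)^[i] 1 := fun i => rfl
    have hPpos : 0 < Function.minimalPeriod f 1 := by
      obtain ⟨i, hi⟩ := ht (f.symm 1)
      refine Function.IsPeriodicPt.minimalPeriod_pos (Nat.succ_pos i) ?_
      change f^[i + 1] 1 = 1
      rw [Function.iterate_succ_apply', hff, hi, Equiv.apply_symm_apply]
    have hP : Function.minimalPeriod f 1 = Nat.card M := by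
      have hb : Function.Bijective (fun i : Fin (Function.minimalPeriod f 1) => f^[i.1] 1) := by
        constructor
        · intro i j hij
          exact Fin.ext (Function.iterate_injOn_Iio_minimalPeriod i.2 j.2 hij)
        · intro x
          obtain ⟨i, hi⟩ := ht x
          refine ⟨⟨i % _, Nat.mod_lt _ hPpos⟩, ?_⟩
          simp only [Function.iterate_mod_minimalPeriod_eq]
          exact hi
      have := Nat.card_congr (Equiv.ofBijective _ hb)
      simpa using this
    have hord : orderOf σ = Nat.card M := by
      rw [← hcard]
      exact orderOf_eq_card_of_forall_mem_zpowers hσ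
    have hwd : ∀ i j : ℕ, σ ^ i = σ ^ j → f^[i] 1 = f^[j] 1 := by
      intro i j hij
      rw [pow_inj_mod, hord, ← hP] at hij
      rw [← Function.iterate_mod_minimalPeriod_eq (n := i), hij,
        Function.iterate_mod_minimalPeriod_eq]
    choose idx hidx using hσ'
    let b₀ : Γ → M := fun γ => f^[idx γ] 1
    have hb₀ : ∀ i : ℕ, b₀ (σ ^ i) = f^[i] 1 := fun i => hwd _ _ (hidx _)
    have hb₀s : Function.Surjective b₀ := by
      intro x
      obtain ⟨i, hi⟩ := ht x
      exact ⟨σ ^ i, (hb₀ i).trans hi⟩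
    have hb₀b : Function.Bijective b₀ :=
      (Nat.bijective_iff_surjective_and_card b₀).2 ⟨hb₀s, hcard⟩
    let b : Γ ≃ M := Equiv.ofBijective b₀ hb₀b
    have hb1 : b 1 = 1 := by
      have := hb₀ 0
      rw [pow_zero] at this
      exact this
    have hbσ : ∀ γ, b (σ * γ) = α (b γ) * a := by
      intro γ
      have h1 : b (σ ^ (idx γ + 1)) = f (b (σ ^ (idx γ))) := by
        change b₀ _ = f (b₀ _)
        rw [hb₀, hb₀, Function.iterate_succ_apply']
      rw [pow_succ', hidx] at h1
      exact h1
    let h₀ : M →* Equiv.Perm Γ :=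
      { toFun := fun x => (b.trans (Equiv.mulLeft x)).trans b.symm
        map_one' := by ext γ; simp
        map_mul' := by intro x y; ext γ; simp }
    have hh₀ : ∀ x γ, h₀ x γ = b.symm (x * b γ) := fun x γ => rfl
    have hnσ : ∀ x, Equiv.mulLeft σ * h₀ x * (Equiv.mulLeft σ)⁻¹ = h₀ (α x) := by
      intro x
      ext γ
      apply b.injective
      have h3 := hbσ (σ⁻¹ * γ)
      rw [mul_inv_cancel_left] at h3
      simp [hh₀, hbσ, h3, mul_assoc]
    have hn : ∀ (i : ℕ) (x : M), ∃ y,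
        Equiv.mulLeft (σ ^ i) * h₀ x * (Equiv.mulLeft (σ ^ i))⁻¹ = h₀ y := by
      intro i
      induction i with
      | zero => intro x; exact ⟨x, by ext γ; simp⟩
      | succ i ih =>
        intro x
        obtain ⟨y, hy⟩ := ih x
        refine ⟨α y, ?_⟩
        rw [← hnσ, ← hy]
        have : Equiv.mulLeft (σ ^ (i + 1)) = Equiv.mulLeft σ * Equiv.mulLeft (σ ^ i) := by
          ext γ
          simp [pow_succ']
        rw [this]
        group
    let h : GoodHom Γ M := ⟨h₀, by
      constructor
      · have : (fun x => h₀ x 1) = b.symm := by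
          ext x
          rw [hh₀, hb1, mul_one]
        rw [this]
        exact b.symm.bijective
      · intro γ x
        rw [← hidx γ]
        exact hn _ x⟩
    refine ⟨h, Subtype.ext (aff_inj fun x => ?_)⟩
    have h4 := hF h x
    have h5 : ∀ x, h.1 x 1 = b.symm x := by
      intro x
      change h₀ x 1 = _
      rw [hh₀, hb1, mul_one]
    rw [h5, h5, Equiv.symm_apply_eq, hbσ, Equiv.apply_symm_apply] at h4
    exact h4
end cyc

namespace Mdl

lemma no_inv {M F : Type} [Group M] [Field F] {α : MulAut M} {a : M} (ht : FullOrbit α a)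
    (φ : M → F) (c : F) (hc : c ≠ 0) (h : ∀ z, φ (aff α a z) = c * φ z)
    (z0 z1 : M) (h0 : φ z0 = 0) (h1 : φ z1 = 1) : False := by
  have hi : ∀ i : ℕ, φ ((aff α a)^[i] 1) = c ^ i * φ 1 := by
    intro i
    induction i with
    | zero => simp
    | succ i ih => rw [Function.iterate_succ_apply', h, ih, pow_succ]; ring
  obtain ⟨i, e0⟩ := ht z0
  obtain ⟨j, e1⟩ := ht z1
  have a0 := hi i
  have a1 := hi j
  rw [e0, h0] at a0
  rw [e1, h1] at a1
  have : φ 1 = 0 := by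
    rcases mul_eq_zero.1 a0.symm with h | h
    · exact absurd h (pow_ne_zero _ hc)
    · exact h
  rw [this, mul_zero] at a1
  exact one_ne_zero a1

variable {g m : ℕ} {K : AddChar (ZMod m) (PR g)}

/-- The local condition. -/
def Q {F : Type} [Field F] (q : F) (c : F × F × F) : Prop :=
  (c.1 = 1 ∧ c.2.1 ≠ 0) ∨ (c.1 = q ∧ c.2.2 ≠ 0)

lemma card_Q {F : Type} [Field F] [Finite F] (q : F) (hq : q ≠ 1) :
    Nat.card {c : F × F × F // Q q c} = 2 * (Nat.card F * (Nat.card F - 1)) := by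
  classical
  have := Fintype.ofFinite F
  have e : ({c : F × F × F | Q q c} : Set (F × F × F)) =
      ((({1} : Finset F) ×ˢ (({0}ᶜ : Finset F) ×ˢ (Finset.univ : Finset F))) ∪
        (({q} : Finset F) ×ˢ ((Finset.univ : Finset F) ×ˢ ({0}ᶜ : Finset F))) :
          Finset (F × F × F)) := by
    ext ⟨s, A, B⟩
    simp [Q]
    tauto
  change Nat.card ({c : F × F × F | Q q c} : Set (F × F × F)) = _
  rw [e, Nat.card_coe_set_eq, Set.ncard_coe_finset, Finset.card_union_of_disjoint]
  · simp [Finset.card_product, Finset.card_compl]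
    ring
  · rw [Finset.disjoint_left]
    rintro ⟨s, A, B⟩ h1 h2
    simp at h1 h2
    exact hq (h2.2.trans h1.2.symm)

lemma aff_mkAut (s : (PR g)ˣ) (t u : PR g) (w : (ZMod m)ˣ) (v : ZMod m) (h) (a : Mdl K) :
    aff (mkAut s t w h) ⟨u, v⟩ a = ⟨s * a.fst + t * (K a.snd - 1) + K a.snd * u,
      w * a.snd + v⟩ := by
  simp only [aff, mkAut_apply]
  ext1
  · simp [h]
  · simp

lemma w_eq_one (hm : Squarefree m) {s : (PR g)ˣ} {t u : PR g} {w : (ZMod m)ˣ} {v : ZMod m} {h}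
    (ht : FullOrbit (mkAut s t w h : MulAut (Mdl K)) ⟨u, v⟩) : w = 1 := by
  have key : ∀ p ∈ m.primeFactors, p ∣ ((w : ZMod m) - 1).val := by
    intro p hp
    have hpp : Fact p.Prime := ⟨Nat.prime_of_mem_primeFactors hp⟩
    have hpm : p ∣ m := Nat.dvd_of_mem_primeFactors hp
    have hm0 : NeZero m := ⟨hm.ne_zero⟩
    let π := ZMod.castHom hpm (ZMod p)
    have hw0 : π w ≠ 0 := (w.isUnit.map π).ne_zero
    have hw1 : π w = 1 := by
      by_contra hne
      have hne' : 1 - π w ≠ 0 := fun h => hne (sub_eq_zero.1 h).symm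
      let β := π v / (1 - π w)
      have hβ : (1 - π w) * β = π v := mul_div_cancel₀ _ hne'
      have hs := ZMod.ringHom_surjective π
      obtain ⟨y0, hy0⟩ := hs β
      obtain ⟨y1, hy1⟩ := hs (β + 1)
      refine no_inv ht (fun z => π z.snd - β) (π w) hw0 ?_ ⟨0, y0⟩ ⟨0, y1⟩ ?_ ?_
      · intro z
        rw [aff_mkAut]
        simp only [map_add, map_mul]
        linear_combination -hβ
      · simp [hy0]
      · simp [hy1]
    have h2 : π ((w : ZMod m) - 1) = 0 := by rw [map_sub, hw1, map_one, sub_self]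
    have h3 : π ((w : ZMod m) - 1) = ((((w : ZMod m) - 1).val : ℕ) : ZMod p) := by
      conv_lhs => rw [← ZMod.natCast_zmod_val ((w : ZMod m) - 1)]
      rw [map_natCast]
    rw [h3] at h2
    exact (ZMod.natCast_eq_zero_iff _ _).1 h2
  have hm0 : NeZero m := ⟨hm.ne_zero⟩
  have h5 := (ZMod.natCast_eq_zero_iff _ _).2 (dvd_of_primes hm key)
  rw [ZMod.natCast_zmod_val, sub_eq_zero] at h5
  exact Units.ext h5

lemma aff_mkAut_one (s : (PR g)ˣ) (t u : PR g) (v : ZMod m) (h) (a : Mdl K) :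
    aff (mkAut s t 1 h) ⟨u, v⟩ a = ⟨s * a.fst - t + (t + u) * K a.snd, a.snd + v⟩ := by
  rw [aff_mkAut]
  ext1
  · ring
  · simp

lemma iter_snd (s : (PR g)ˣ) (t u : PR g) (v : ZMod m) (h) (i : ℕ) :
    ((aff (mkAut s t 1 h : MulAut (Mdl K)) ⟨u, v⟩)^[i] 1).snd = i * v := by
  induction i with
  | zero => simp
  | succ i ih => rw [Function.iterate_succ_apply', aff_mkAut_one]; simp only [ih]; push_cast; ring

lemma v_unit {s : (PR g)ˣ} {t u : PR g} {v : ZMod m} {h}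
    (ht : FullOrbit (mkAut s t 1 h : MulAut (Mdl K)) ⟨u, v⟩) : IsUnit v := by
  obtain ⟨i, hi⟩ := ht ⟨0, 1⟩
  have := iter_snd s t u v h i
  rw [hi] at this
  exact IsUnit.of_mul_eq_one_right (b := v) (i : ZMod m) this.symm

lemma Kv_ne_one (hm : m ≠ 0) (hK : IsUnit (K 1 - 1)) {v : ZMod m} (hv : IsUnit v)
    (p : g.primeFactors) : K v p ≠ 1 := by
  intro h
  have hm0 : NeZero m := ⟨hm⟩
  obtain ⟨v, rfl⟩ := hv
  have h1 : (1 : ZMod m) = ((v⁻¹ : (ZMod m)ˣ) : ZMod m).val • (v : ZMod m) := by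
    rw [nsmul_eq_mul, ZMod.natCast_zmod_val]
    simp
  have h2 : K 1 p = 1 := by
    rw [h1, AddChar.map_nsmul_eq_pow, Pi.pow_apply, h, one_pow]
  have h3 := (Pi.isUnit_iff.1 hK p).ne_zero
  simp [h2] at h3

lemma K_ne_zero (y : ZMod m) (p : g.primeFactors) : K y p ≠ 0 :=
  (Pi.isUnit_iff.1 (AddChar.val_isUnit K y) p).ne_zero

lemma local_cond {s : (PR g)ˣ} {t u : PR g} {v : ZMod m} {h}
    (ht : FullOrbit (mkAut s t 1 h : MulAut (Mdl K)) ⟨u, v⟩) (p : g.primeFactors) :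
    Q (K v p) ((s : PR g) p, (-t) p, (t + u) p) := by
  by_contra hQ
  simp only [Q, not_or, not_and, not_not] at hQ
  obtain ⟨hA, hB⟩ := hQ
  set A := (-t) p with hA'
  set B := (t + u) p with hB'
  set σ := (s : PR g) p with hσ
  set q := K v p with hq
  have hσ0 : σ ≠ 0 := (Pi.isUnit_iff.1 s.isUnit p).ne_zero
  obtain ⟨a, ha⟩ : ∃ a, (1 - σ) * a = A := by
    by_cases h1 : σ = 1
    · exact ⟨0, by rw [hA h1]; simp⟩
    · exact ⟨A / (1 - σ), mul_div_cancel₀ _ (fun h => h1 (sub_eq_zero.1 h).symm)⟩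
  obtain ⟨b, hb⟩ : ∃ b, (q - σ) * b = B := by
    by_cases h1 : σ = q
    · exact ⟨0, by rw [hB h1]; simp⟩
    · exact ⟨B / (q - σ), mul_div_cancel₀ _ (fun h => h1 (sub_eq_zero.1 h).symm)⟩
  refine no_inv ht (fun z => z.fst p - (a + b * K z.snd p)) σ hσ0 ?_
    ⟨Pi.single p (a + b), 0⟩ ⟨Pi.single p (a + b + 1), 0⟩ ?_ ?_
  · intro z
    rw [aff_mkAut_one]
    have e1 : ((s : PR g) * z.fst - t + (t + u) * K z.snd) p =
        σ * z.fst p + A + B * K z.snd p := by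
      simp only [Pi.add_apply, Pi.sub_apply, Pi.mul_apply, Pi.neg_apply, hA', hB', hσ]
      ring
    have e2 : K (z.snd + v) p = K z.snd p * q := by
      rw [AddChar.map_add_eq_mul, Pi.mul_apply]
    simp only [e1, e2]
    linear_combination -ha - K z.snd p * hb
  · simp
  · simp

lemma scalar {F : Type} [Field F] {q σ A B : F} (hq0 : q ≠ 0) (hq1 : q ≠ 1)
    (hQ : Q q (σ, A, B)) (x : ℕ → F) (h0 : x 0 = 0)
    (hrec : ∀ i, x (i + 1) = σ * x i + A + B * q ^ i) (X k : F) (hk : k ≠ 0) :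
    ∃ D : F, ∀ i : ℕ, (i : F) = D → q ^ i = k → x i = X := by
  have hq1' : q - 1 ≠ 0 := sub_ne_zero.2 hq1
  simp only [Q] at hQ
  rcases hQ with ⟨rfl, hA⟩ | ⟨rfl, hB⟩
  · have hx : ∀ i : ℕ, x i = B / (q - 1) * (q ^ i - 1) + i * A := by
      intro i
      induction i with
      | zero => simp [h0]
      | succ i ih =>
        rw [hrec, ih]
        push_cast
        field_simp
        ring
    refine ⟨(X - B / (q - 1) * (k - 1)) / A, fun i hi hki => ?_⟩
    rw [hx, hi, hki, div_mul_cancel₀ _ hA]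
    ring
  · have hx : ∀ i : ℕ, x i = A / (σ - 1) * (σ ^ i - 1) + i * (B / σ * σ ^ i) := by
      intro i
      induction i with
      | zero => simp [h0]
      | succ i ih =>
        rw [hrec, ih]
        push_cast
        field_simp
        ring
    refine ⟨(X - A / (σ - 1) * (k - 1)) / (B / σ * k), fun i hi hki => ?_⟩
    rw [hx, hi, hki, div_mul_cancel₀ _ (mul_ne_zero (div_ne_zero hB hq0) hk)]
    ring

lemma fullOrbit_of_cond (hc : ∀ (x : PR g) (y : ZMod m), ∃ i : ℕ, (i : PR g) = x ∧ (i : ZMod m) = y)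
    (hm : m ≠ 0) (hK : IsUnit (K 1 - 1)) {s : (PR g)ˣ} {t u : PR g} {v : ZMod m} {h}
    (hv : IsUnit v) (hQ : ∀ p, Q (K v p) ((s : PR g) p, (-t) p, (t + u) p)) :
    FullOrbit (mkAut s t 1 h : MulAut (Mdl K)) ⟨u, v⟩ := by
  -- for each prime: closed form of the orbit and solvability
  have key : ∀ (X : PR g) (Y : ZMod m) (p : g.primeFactors), ∃ D : ZMod p.1, ∀ i : ℕ,
      (i : ZMod p.1) = D → (i : ZMod m) * v = Y →
      ((aff (mkAut s t 1 h : MulAut (Mdl K)) ⟨u, v⟩)^[i] 1).fst p = X p := by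
    intro X Y p
    have hq1 := Kv_ne_one hm hK hv p
    have hrec : ∀ i : ℕ, ((aff (mkAut s t 1 h : MulAut (Mdl K)) ⟨u, v⟩)^[i + 1] 1).fst p =
        (s : PR g) p * ((aff (mkAut s t 1 h : MulAut (Mdl K)) ⟨u, v⟩)^[i] 1).fst p + (-t) p
          + (t + u) p * (K v p) ^ i := by
      intro i
      rw [Function.iterate_succ_apply', aff_mkAut_one]
      simp only [iter_snd]
      rw [← nsmul_eq_mul, AddChar.map_nsmul_eq_pow]
      simp only [Pi.add_apply, Pi.sub_apply, Pi.mul_apply, Pi.neg_apply, Pi.pow_apply]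
      ring
    have hKi : ∀ i : ℕ, (i : ZMod m) * v = Y → (K v p) ^ i = K Y p := by
      rintro i rfl
      rw [← nsmul_eq_mul, AddChar.map_nsmul_eq_pow, Pi.pow_apply]
    obtain ⟨D, hD⟩ := scalar (K_ne_zero v p) hq1 (hQ p)
      (fun i : ℕ => ((aff (mkAut s t 1 h : MulAut (Mdl K)) ⟨u, v⟩)^[i] 1).fst p) (by simp)
      hrec (X p) (K Y p) (K_ne_zero Y p)
    exact ⟨D, fun i hi hiv => hD i hi (hKi i hiv)⟩
  rintro ⟨X, Y⟩
  choose D hD using key X Y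
  obtain ⟨v, rfl⟩ := hv
  obtain ⟨i, hi, hi'⟩ := hc D (Y * (v⁻¹ : (ZMod m)ˣ))
  have hiv : (i : ZMod m) * v = Y := by rw [hi']; simp
  refine ⟨i, ?_⟩
  ext1
  · ext p
    exact hD p i (by rw [← hi]; simp) hiv
  · rw [iter_snd, hiv]

lemma card_fullOrbit
    (hc : ∀ (x : PR g) (y : ZMod m), ∃ i : ℕ, (i : PR g) = x ∧ (i : ZMod m) = y)
    (hm : Squarefree m) (hK : IsUnit (K 1 - 1)) :
    Nat.card {q : MulAut (Mdl K) × Mdl K // FullOrbit q.1 q.2} =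
      m.totient * ∏ p : g.primeFactors, (2 * (p.1 * (p.1 - 1))) := by
  have hm0 : NeZero m := ⟨hm.ne_zero⟩
  have hc1 : ∀ v : (ZMod m)ˣ, Nat.card ((p : g.primeFactors) →
      {c : ZMod p.1 × ZMod p.1 × ZMod p.1 // Q (K v p) c}) =
      ∏ p : g.primeFactors, (2 * (p.1 * (p.1 - 1))) := by
    intro v
    rw [Nat.card_pi]
    refine Finset.prod_congr rfl fun p _ => ?_
    rw [card_Q _ (Kv_ne_one hm.ne_zero hK v.isUnit p), Nat.card_zmod]
  have hc2 : Nat.card (Σ v : (ZMod m)ˣ, ((p : g.primeFactors) →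
      {c : ZMod p.1 × ZMod p.1 × ZMod p.1 // Q (K v p) c})) =
      m.totient * ∏ p : g.primeFactors, (2 * (p.1 * (p.1 - 1))) := by
    rw [Nat.card_sigma, Finset.sum_congr rfl fun v _ => hc1 v, Finset.sum_const, Finset.card_univ,
      ZMod.card_units_eq_totient, smul_eq_mul]
  rw [← hc2]
  have hone : ∀ y : ZMod m, K (((1 : (ZMod m)ˣ) : ZMod m) * y) = K y := by simp
  have hunit : ∀ (v : (ZMod m)ˣ) (c : (p : g.primeFactors) →
      {c : ZMod p.1 × ZMod p.1 × ZMod p.1 // Q (K v p) c}),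
      IsUnit ((fun p => (c p).1.1) : PR g) := by
    intro v c
    rw [Pi.isUnit_iff]
    intro p
    rw [isUnit_iff_ne_zero]
    rcases (c p).2 with h | h
    · rw [h.1]; exact one_ne_zero
    · rw [h.1]; exact K_ne_zero _ _
  have hfo : ∀ q : (Σ v : (ZMod m)ˣ, ((p : g.primeFactors) →
      {c : ZMod p.1 × ZMod p.1 × ZMod p.1 // Q (K v p) c})),
      FullOrbit (mkAut (hunit q.1 q.2).unit (fun p => -(q.2 p).1.2.1) 1 hone : MulAut (Mdl K))
      ⟨fun p => (q.2 p).1.2.1 + (q.2 p).1.2.2, q.1⟩ := by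
    intro q
    refine fullOrbit_of_cond hc hm.ne_zero hK q.1.isUnit fun p => ?_
    have := (q.2 p).2
    convert this using 1
    ext <;> simp
  refine (Nat.card_congr (Equiv.ofBijective
    (fun q : (Σ v : (ZMod m)ˣ, ((p : g.primeFactors) →
      {c : ZMod p.1 × ZMod p.1 × ZMod p.1 // Q (K v p) c})) =>
      (⟨(mkAut (hunit q.1 q.2).unit (fun p => -(q.2 p).1.2.1) 1 hone,
      ⟨fun p => (q.2 p).1.2.1 + (q.2 p).1.2.2, q.1⟩), hfo q⟩ :
        {q : MulAut (Mdl K) × Mdl K // FullOrbit q.1 q.2})) ⟨?_, ?_⟩)).symm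
  · rintro ⟨v, c⟩ ⟨v', c'⟩ he
    have he := Subtype.ext_iff.1 he
    simp only [Prod.mk.injEq, Mdl.mk.injEq] at he
    obtain ⟨h1, h2, h3⟩ := he
    obtain ⟨h4, h5, -⟩ := mkAut_inj hK h1
    obtain rfl := Units.ext h3
    congr 1
    ext p : 2
    have a1 := congrFun (congrArg (Units.val) h4) p
    have a2 := congrFun h5 p
    have a3 := congrFun h2 p
    simp at a1 a2 a3
    rw [a2] at a3
    exact Prod.ext a1 (Prod.ext a2 (add_left_cancel a3))
  · rintro ⟨⟨α, ⟨u, v⟩⟩, ht⟩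
    obtain ⟨s, t, w, h, rfl⟩ := exists_mkAut hc hK α
    simp only at ht
    obtain rfl := w_eq_one hm ht
    obtain ⟨v, rfl⟩ := v_unit ht
    refine ⟨⟨v, fun p => ⟨((s : PR g) p, (-t) p, (t + u) p), local_cond ht p⟩⟩, ?_⟩
    apply Subtype.ext
    simp only [Prod.mk.injEq, Mdl.mk.injEq]
    refine ⟨?_, ?_, trivial⟩
    · congr 1
      · ext1; rfl
      · ext p; simp
    · ext p; simp

lemma card_units_PR : Nat.card (PR g)ˣ = ∏ p : g.primeFactors, (p.1 - 1) := by
  rw [Nat.card_congr (MulEquiv.piUnits (M := fun p : g.primeFactors => ZMod p.1)).toEquiv, Nat.card_pi]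
  refine Finset.prod_congr rfl fun p _ => ?_
  rw [Nat.card_eq_fintype_card, ZMod.card_units]

lemma K_eq_one_iff (hm : m ≠ 0) (hd : orderOf (K 1) ∣ m) (y : ZMod m) :
    K y = 1 ↔ ZMod.castHom hd (ZMod (orderOf (K 1))) y = 0 := by
  have hm0 : NeZero m := ⟨hm⟩
  conv_lhs => rw [← ZMod.natCast_zmod_val y, ← nsmul_one, AddChar.map_nsmul_eq_pow]
  conv_rhs => rw [← ZMod.natCast_zmod_val y, map_natCast]
  rw [ZMod.natCast_eq_zero_iff, orderOf_dvd_iff_pow_eq_one]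

lemma ord_dvd : orderOf (K 1) ∣ m := by
  rw [orderOf_dvd_iff_pow_eq_one, ← AddChar.map_nsmul_eq_pow]
  simp

lemma card_ker (hm : m ≠ 0) :
    Nat.card {y : ZMod m // K y = 1} * orderOf (K 1) = m := by
  have hm0 : NeZero m := ⟨hm⟩
  let f : ZMod m →+ ZMod (orderOf (K 1)) := (ZMod.castHom ord_dvd (ZMod (orderOf (K 1)))).toAddMonoidHom
  have hf : Function.Surjective f := ZMod.ringHom_surjective (ZMod.castHom (ord_dvd (K := K)) _)
  have h1 := AddSubgroup.card_mul_index f.ker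
  rw [AddSubgroup.index_ker, AddMonoidHom.range_eq_top.2 hf] at h1
  simp only [AddSubgroup.card_top, Nat.card_zmod] at h1
  conv_rhs => rw [← h1]
  congr 1
  exact Nat.card_congr (Equiv.subtypeEquivRight fun y => K_eq_one_iff hm ord_dvd y)

lemma card_W (hm : m ≠ 0) :
    Nat.card {w : (ZMod m)ˣ // ∀ y, K (w * y) = K y} * (orderOf (K 1)).totient = m.totient := by
  have hm0 : NeZero m := ⟨hm⟩
  have hd0 : NeZero (orderOf (K 1)) :=
    ⟨fun h => hm (Nat.eq_zero_of_zero_dvd (h ▸ ord_dvd (K := K)))⟩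
  have hf := ZMod.unitsMap_surjective (ord_dvd (K := K))
  have h1 := Subgroup.card_mul_index (ZMod.unitsMap (ord_dvd (K := K))).ker
  rw [Subgroup.index_ker, MonoidHom.range_eq_top.2 hf] at h1
  simp only [Subgroup.card_top, Nat.card_eq_fintype_card, ZMod.card_units_eq_totient] at h1
  rw [← h1]
  congr 1
  rw [← Nat.card_eq_fintype_card]
  refine Nat.card_congr (Equiv.subtypeEquivRight fun w => ?_)
  rw [MonoidHom.mem_ker, Units.ext_iff, ZMod.unitsMap_def, Units.coe_map, Units.val_one,
    ← sub_eq_zero, MonoidHom.coe_coe]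
  have hsub : ZMod.castHom (ord_dvd (K := K)) (ZMod (orderOf (K 1))) (w : ZMod m) - 1 =
      ZMod.castHom (ord_dvd (K := K)) (ZMod (orderOf (K 1))) ((w : ZMod m) - 1) := by
    rw [map_sub, map_one (ZMod.castHom (ord_dvd (K := K)) (ZMod (orderOf (K 1))))]
  rw [hsub, ← K_eq_one_iff hm]
  have hz : ∀ y : ZMod m, K (w * y) = K ((w - 1) * y) * K y := by
    intro y
    rw [← AddChar.map_add_eq_mul]
    congr 1
    ring
  constructor
  · intro h
    have := hz 1
    rw [h, mul_one] at this
    exact ((AddChar.val_isUnit K 1).mul_eq_right.1 this.symm)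
  · intro h y
    rw [hz, ← ZMod.natCast_zmod_val y, mul_comm _ ((y.val : ℕ) : ZMod m), ← nsmul_eq_mul,
      AddChar.map_nsmul_eq_pow, h, one_pow, one_mul]

end Mdl

lemma exists_model (G : Type) [Group G] [Finite G] (hn : Squarefree (Nat.card G)) :
    ∃ (g m : ℕ) (K : AddChar (ZMod m) (PR g)), g = Nat.card (commutator G) ∧
      Nat.card G = g * m ∧ IsUnit (K 1 - 1) ∧ Nonempty (Mdl K ≃* G) := by
  have hZ : IsZGroup G := IsZGroup.of_squarefree hn
  have hcyc : IsCyclic (commutator G) := IsZGroup.isCyclic_commutator G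
  obtain ⟨H, hH⟩ := Subgroup.exists_right_complement'_of_coprime
    (IsZGroup.coprime_commutator_index G)
  have hHcyc : IsCyclic H := by
    have e := (hH.symm.QuotientMulEquiv)
    have : IsCyclic (G ⧸ commutator G) := IsZGroup.isCyclic_abelianization (G := G)
    exact isCyclic_of_surjective e e.surjective
  set g := Nat.card (commutator G) with hg
  set m := Nat.card H with hm
  have hgm : Nat.card G = g * m := hH.card_mul_card.symm
  have hgsq : Squarefree g := hn.squarefree_of_dvd ⟨m, hgm⟩
  have hm0 : m ≠ 0 := Nat.card_pos.ne'
  have hcop : g.Coprime m := by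
    rw [hgm] at hn
    exact Nat.coprime_of_squarefree_mul hn
  have hc := PR_cast_surj hgsq hm0 hcop
  -- R is cyclic
  have hRc : IsAddCyclic (PR g) := by
    refine ⟨1, fun x => ?_⟩
    obtain ⟨i, hi, -⟩ := hc x 0
    exact ⟨i, by simp [hi]⟩
  let i : Multiplicative (PR g) ≃* commutator G :=
    mulEquivOfCyclicCardEq (by rw [Nat.card_congr Multiplicative.toAdd, PR_card g hgsq])
  let j : Multiplicative (ZMod m) ≃* H :=
    mulEquivOfCyclicCardEq (by rw [Nat.card_congr Multiplicative.toAdd, Nat.card_zmod])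
  let I : PR g → G := fun x => (i (Multiplicative.ofAdd x) : G)
  let J : ZMod m → G := fun x => (j (Multiplicative.ofAdd x) : G)
  have hI : ∀ x y, I (x + y) = I x * I y := by
    intro x y
    simp [I]
  have hJ : ∀ x y, J (x + y) = J x * J y := by
    intro x y
    simp [J]
  have hI0 : I 0 = 1 := by simp [I]
  have hJ0 : J 0 = 1 := by simp [J]
  have hIinj : Function.Injective I := fun x y h => by
    have := i.injective (Subtype.ext h)
    exact this
  have hImem : ∀ x, I x ∈ commutator G := fun x => (i _).2
  have hIsurj : ∀ a ∈ commutator G, ∃ x, I x = a := by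
    intro a ha
    refine ⟨Multiplicative.toAdd (i.symm ⟨a, ha⟩), ?_⟩
    simp [I]
  have hInat : ∀ (k : ℕ) x, I (k * x) = I x ^ k := by
    intro k x
    induction k with
    | zero => simp [hI0]
    | succ k ih =>
      rw [pow_succ, ← ih, ← hI]
      congr 1
      push_cast
      ring
  have hconj : ∀ y, ∃ c, I c = J y * I 1 * (J y)⁻¹ := fun y =>
    hIsurj _ ((inferInstance : (commutator G).Normal).conj_mem _ (hImem 1) _)
  choose κ hκ using hconj
  have hκI : ∀ y x, J y * I x * (J y)⁻¹ = I (κ y * x) := by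
    intro y x
    obtain ⟨k, hk, -⟩ := hc x 0
    have h1 : I x = I 1 ^ k := by rw [← hInat, hk, mul_one]
    rw [h1, ← conj_pow, ← hκ, ← hInat, hk, mul_comm]
  let K : AddChar (ZMod m) (PR g) :=
    { toFun := κ
      map_zero_eq_one' := by
        apply hIinj
        rw [hκ, hJ0]
        simp
      map_add_eq_mul' := by
        intro a b
        apply hIinj
        rw [← hκI, hκ, hκ, hJ]
        group }
  have hK : ∀ y x, J y * I x * (J y)⁻¹ = I (K y * x) := hκI
  let f : Mdl K →* G :=
    { toFun := fun a => I a.fst * J a.snd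
      map_one' := by simp [hI0, hJ0]
      map_mul' := by
        intro a b
        simp only [Mdl.mul_fst, Mdl.mul_snd, hI, hJ, ← hK]
        group }
  have hf : Function.Bijective f := by
    have h1 : Function.Bijective (fun x : commutator G × H => x.1.1 * x.2.1) := hH
    have h2 : (f : Mdl K → G) = (fun x : commutator G × H => x.1.1 * x.2.1) ∘
        (fun a : Mdl K => (i (Multiplicative.ofAdd a.fst), j (Multiplicative.ofAdd a.snd))) := rfl
    rw [h2]
    refine h1.comp ⟨?_, ?_⟩
    · intro a b hab
      simp only [Prod.mk.injEq, EmbeddingLike.apply_eq_iff_eq] at hab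
      exact Mdl.ext hab.1 hab.2
    · rintro ⟨a, b⟩
      refine ⟨⟨Multiplicative.toAdd (i.symm a), Multiplicative.toAdd (j.symm b)⟩, ?_⟩
      simp
  let e : Mdl K ≃* G := MulEquiv.ofBijective f hf
  refine ⟨g, m, K, rfl, hgm, ?_, ⟨e⟩⟩
  rw [Pi.isUnit_iff]
  intro p
  rw [isUnit_iff_ne_zero, Pi.sub_apply, Pi.one_apply, sub_ne_zero]
  intro h1
  have hm0' : NeZero m := ⟨hm0⟩
  have hall : ∀ y, K y p = 1 := by
    intro y
    rw [← ZMod.natCast_zmod_val y, ← nsmul_one, AddChar.map_nsmul_eq_pow, Pi.pow_apply, h1, one_pow]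
  let ψ : Mdl K →* Multiplicative (ZMod p.1) :=
    { toFun := fun a => Multiplicative.ofAdd (a.fst p)
      map_one' := by simp
      map_mul' := by
        intro a b
        simp [hall] }
  have h2 := Abelianization.commutator_subset_ker (ψ.comp e.symm.toMonoidHom) (hImem 1)
  have h3 : e.symm (I 1) = ⟨1, 0⟩ := by
    rw [MulEquiv.symm_apply_eq]
    change I 1 = I 1 * J 0
    rw [hJ0, mul_one]
  rw [MonoidHom.mem_ker] at h2
  simp [h3, ψ] at h2

lemma card_center {g m : ℕ} {K : AddChar (ZMod m) (PR g)} (hK : IsUnit (K 1 - 1)) :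
    Nat.card (Subgroup.center (Mdl K)) = Nat.card {y : ZMod m // K y = 1} := by
  refine (Nat.card_congr (Equiv.ofBijective
    (fun y : {y : ZMod m // K y = 1} => (⟨⟨0, y.1⟩, ?_⟩ : Subgroup.center (Mdl K))) ⟨?_, ?_⟩)).symm
  · rw [Subgroup.mem_center_iff]
    intro a
    ext1
    · simp [y.2]
    · simp [add_comm]
  · intro y y' h
    have := congrArg (fun a : Subgroup.center (Mdl K) => a.1.snd) h
    exact Subtype.ext this
  · rintro ⟨⟨x, y⟩, h⟩
    rw [Subgroup.mem_center_iff] at h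
    have h1 := congrArg Mdl.fst (h ⟨0, 1⟩)
    have h2 := congrArg Mdl.fst (h ⟨1, 0⟩)
    simp at h1 h2
    have hx : x = 0 := by
      have : (K 1 - 1) * x = 0 := by rw [sub_mul, h1, one_mul, sub_self]
      exact hK.mul_right_eq_zero.1 this
    subst hx
    have hy : K y = 1 := by simpa using h2.symm
    exact ⟨⟨y, hy⟩, rfl⟩

/-- **Theorem 1 (Alabdali–Byott).** Let `n` be squarefree, `Γ` cyclic of order `n` and `G`
any group of order `n`, with `z = |Z(G)|`, `g = |G'|`, `d = n/(gz)`. Then the number of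
regular subgroups of `Perm Γ` isomorphic to `G` and normalised by the left translations
(i.e. the number of Hopf–Galois structures of type `G` on a cyclic extension of degree `n`)
is `2^{ω(g)} φ(d)`. -/
theorem hgs_count_of_type (n : ℕ) (hn : Squarefree n)
    (Γ : Type) [Group Γ] [IsCyclic Γ] (hΓ : Nat.card Γ = n)
    (G : Type) [Group G] (hG : Nat.card G = n)
    (z g d : ℕ) (hz : z = Nat.card (Subgroup.center G))
    (hg : g = Nat.card (commutator G))
    (hd : d = n / (g * z)) :
    Nat.card {N : Subgroup (Equiv.Perm Γ) //
        Nonempty (N ≃* G) ∧ IsRegularSubgroup Γ N ∧ IsNormalizedByLeftTranslations Γ N} =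
      2 ^ g.primeFactors.card * Nat.totient d := by
  have hn0 : n ≠ 0 := hn.ne_zero
  have hΓf : Finite Γ := Nat.finite_of_card_ne_zero (hΓ ▸ hn0)
  have hGf : Finite G := Nat.finite_of_card_ne_zero (hG ▸ hn0)
  obtain ⟨g', m, K, hg', hgm, hK, ⟨e⟩⟩ := exists_model G (hG ▸ hn)
  obtain rfl : g' = g := hg'.trans hg.symm
  rw [hG] at hgm
  have hMf : Finite (Mdl K) := Finite.of_equiv G e.symm.toEquiv
  have hMc : Nat.card (Mdl K) = n := (Nat.card_congr e.toEquiv).trans hG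
  have hgsq : Squarefree g' := hn.squarefree_of_dvd ⟨m, hgm⟩
  have hmsq : Squarefree m := hn.squarefree_of_dvd ⟨g', by rw [hgm, mul_comm]⟩
  have hm0 : m ≠ 0 := hmsq.ne_zero
  have hg0 : g' ≠ 0 := hgsq.ne_zero
  have hcop : g'.Coprime m := by
    rw [hgm] at hn
    exact Nat.coprime_of_squarefree_mul hn
  have hc := PR_cast_surj hgsq hm0 hcop
  have hzc : z = Nat.card {y : ZMod m // K y = 1} := by
    rw [hz, ← card_center hK]
    exact Nat.card_congr (Subgroup.centerCongr e.symm).toEquiv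
  have hzm : z * orderOf (K 1) = m := by rw [hzc]; exact Mdl.card_ker hm0
  have hz0 : 0 < z := Nat.pos_of_ne_zero fun h => hm0 (by rw [← hzm, h, zero_mul])
  have hdo : d = orderOf (K 1) := by
    have h0 : n = g' * z * orderOf (K 1) := by rw [hgm, mul_assoc, hzm]
    rw [hd, h0]
    exact Nat.mul_div_cancel_left _ (Nat.mul_pos (Nat.pos_of_ne_zero hg0) hz0)
  have hN : Nat.card {N : Subgroup (Equiv.Perm Γ) //
        Nonempty (N ≃* G) ∧ IsRegularSubgroup Γ N ∧ IsNormalizedByLeftTranslations Γ N} =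
      Nat.card {N : Subgroup (Equiv.Perm Γ) //
        Nonempty (N ≃* Mdl K) ∧ IsRegularSubgroup Γ N ∧ IsNormalizedByLeftTranslations Γ N} := by
    refine Nat.card_congr (Equiv.subtypeEquivRight fun N => and_congr_left fun _ => ?_)
    exact ⟨fun ⟨f⟩ => ⟨f.trans e.symm⟩, fun ⟨f⟩ => ⟨f.trans e⟩⟩
  have h1 := (card_goodHom Γ (Mdl K)).symm.trans
    (card_goodHom' (Γ := Γ) (M := Mdl K) (hΓ.trans hMc.symm))
  rw [Mdl.card_fullOrbit hc hmsq hK, ← Mdl.card_W (K := K) hm0, ← hN] at h1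
  have hA := Mdl.card_aut hc hK
  have hApos : 0 < Nat.card (MulAut (Mdl K)) := Nat.card_pos
  apply Nat.eq_of_mul_eq_mul_right hApos
  rw [h1, hA, hdo, Mdl.card_units_PR, Nat.card_pi]
  simp only [Nat.card_zmod, Finset.prod_mul_distrib, Finset.prod_const, Finset.card_univ,
    Fintype.card_coe]
  ring
end

section
/- Let G = G(d,e,k) be a group of squarefree order n = d·e, with generators σ of order e and τ of order d satisfying τστ⁻¹ = σ^k, and set z = gcd(e, k−1) and g = e/z. Then |Aut(G)| = g·φ(e), and Aut(G) ≅ C_g ⋊ U(e), where a ∈ U(e) acts on the cyclic group C_g of order g by x ↦ x^a. Explicitly, Aut(G) is generated by the automorphism θ with θ(σ) = σ, θ(τ) = σ^z τ, together with the automorphisms φ_s for s ∈ U(e) with φ_s(σ) = σ^s, φ_s(τ) = τ; these satisfy θ^g = id, φ_s∘φ_t = φ_{st}, and φ_s∘θ∘φ_s⁻¹ = θ^s. -/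
namespace GdekAux

lemma push {H : Type*} [Group H] {s t : H} {k : ℕ} (h : t * s * t⁻¹ = s ^ k) (j a : ℕ) :
    t ^ j * s ^ a = s ^ (a * k ^ j) * t ^ j := by
  induction j generalizing a with
  | zero => simp
  | succ j ih =>
    have h1 : t * s ^ a = s ^ (a * k) * t := by
      have : (t * s * t⁻¹) ^ a = t * s ^ a * t⁻¹ := conj_pow
      rw [h, ← pow_mul, mul_comm k a] at this
      rw [this]; group
    rw [pow_succ, mul_assoc, h1, ← mul_assoc, ih, pow_succ, mul_assoc, mul_assoc,
      mul_comm (k ^ j) k]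

lemma normal {H : Type*} [Group H] {s t : H} {k d e : ℕ} (hd : 0 < d) (he : 0 < e)
    (h : t * s * t⁻¹ = s ^ k) (hs : s ^ e = 1) (ht : t ^ d = 1) {x : H}
    (hx : x ∈ Subgroup.closure {s, t}) : ∃ a b : ℕ, x = s ^ a * t ^ b := by
  have hsi : s⁻¹ = s ^ (e - 1) := by
    rw [inv_eq_iff_mul_eq_one, ← pow_succ', Nat.sub_add_cancel he, hs]
  have hti : t⁻¹ = t ^ (d - 1) := by
    rw [inv_eq_iff_mul_eq_one, ← pow_succ', Nat.sub_add_cancel hd, ht]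
  have key : ∀ a b c f : ℕ, ∃ a' b' : ℕ, (s ^ a * t ^ b) * (s ^ c * t ^ f) = s ^ a' * t ^ b' := by
    intro a b c f
    refine ⟨a + c * k ^ b, b + f, ?_⟩
    rw [mul_assoc, ← mul_assoc (t ^ b), push h, pow_add, pow_add]
    simp only [mul_assoc]
  induction hx using Subgroup.closure_induction with
  | mem x hx =>
    rcases hx with rfl | hx
    · exact ⟨1, 0, by simp⟩
    · exact ⟨0, 1, by rw [Set.mem_singleton_iff.1 hx]; simp⟩
  | one => exact ⟨0, 0, by simp⟩
  | mul x y _ _ hx hy =>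
    obtain ⟨a, b, rfl⟩ := hx
    obtain ⟨c, f, rfl⟩ := hy
    exact key a b c f
  | inv x _ hx =>
    obtain ⟨a, b, rfl⟩ := hx
    have : (s ^ a * t ^ b)⁻¹ =
        (s ^ 0 * t ^ ((d - 1) * b)) * (s ^ ((e - 1) * a) * t ^ 0) := by
      rw [mul_inv_rev, ← inv_pow, ← inv_pow, hsi, hti, ← pow_mul, ← pow_mul]; simp
    rw [this]
    exact key _ _ _ _

lemma powST {H : Type*} [Group H] {s t : H} {k : ℕ} (h : t * s * t⁻¹ = s ^ k) (b n : ℕ) :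
    (s ^ b * t) ^ n = s ^ (b * ∑ i ∈ Finset.range n, k ^ i) * t ^ n := by
  induction n with
  | zero => simp
  | succ n ih =>
    rw [pow_succ, ih, mul_assoc, ← mul_assoc (t ^ n), push h, Finset.sum_range_succ, mul_add,
      pow_add, pow_succ t]
    simp only [mul_assoc]

lemma powST' {H : Type*} [Group H] {s t : H} {k : ℕ} (h : t * s * t⁻¹ = s ^ k) (a b n : ℕ) :
    ∃ c, (s ^ a * t ^ b) ^ n = s ^ c * t ^ (b * n) := by
  induction n with
  | zero => exact ⟨0, by simp⟩
  | succ n ih =>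
    obtain ⟨c, hc⟩ := ih
    refine ⟨c + a * k ^ (b * n), ?_⟩
    rw [pow_succ, hc, mul_assoc, ← mul_assoc (t ^ _), push h, pow_add, mul_add, mul_one,
      pow_add t]
    simp only [mul_assoc]

lemma triv {G : Type*} [Group G] {σ τ : G} (hcop : Nat.Coprime (orderOf τ) (orderOf σ))
    {a b : ℕ} (h : σ ^ a * τ ^ b = 1) : orderOf σ ∣ a ∧ orderOf τ ∣ b := by
  have h1 : σ ^ a = (τ ^ b)⁻¹ := eq_inv_of_mul_eq_one_left h
  have h2 : orderOf (σ ^ a) ∣ orderOf σ := orderOf_pow_dvd a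
  have h3 : orderOf (σ ^ a) ∣ orderOf τ := by
    rw [h1, orderOf_inv]; exact orderOf_pow_dvd b
  have h4 : σ ^ a = 1 := by
    rw [← orderOf_eq_one_iff]
    exact Nat.eq_one_of_dvd_coprimes hcop h3 h2
  rw [h4, one_mul] at h
  exact ⟨orderOf_dvd_of_pow_eq_one h4, orderOf_dvd_of_pow_eq_one h⟩

lemma exists_hom {G H : Type*} [Group G] [Group H] {σ τ : G} {k : ℕ}
    (hd : 0 < orderOf τ) (he : 0 < orderOf σ)
    (hcop : Nat.Coprime (orderOf τ) (orderOf σ))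
    (hrel : τ * σ * τ⁻¹ = σ ^ k) (hgen : Subgroup.closure {σ, τ} = ⊤)
    (s t : H) (hs : s ^ orderOf σ = 1) (ht : t ^ orderOf τ = 1) (h : t * s * t⁻¹ = s ^ k) :
    ∃ f : G →* H, f σ = s ∧ f τ = t := by
  let S : G × H := (σ, s)
  let T : G × H := (τ, t)
  let K : Subgroup (G × H) := Subgroup.closure {S, T}
  let p : K →* G := (MonoidHom.fst G H).comp K.subtype
  have hS : S ∈ K := Subgroup.subset_closure (by simp)
  have hT : T ∈ K := Subgroup.subset_closure (by simp)
  have hinj : Function.Injective p := by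
    rw [injective_iff_map_eq_one]
    rintro ⟨x, hx⟩ h1
    obtain ⟨a, b, rfl⟩ := normal (s := S) (t := T) (k := k) hd he
      (by simp [S, T, hrel, h])
      (by simp [S, Prod.ext_iff, hs, pow_orderOf_eq_one])
      (by simp [T, Prod.ext_iff, ht, pow_orderOf_eq_one]) hx
    have h2 : σ ^ a * τ ^ b = 1 := h1
    obtain ⟨⟨a', rfl⟩, ⟨b', rfl⟩⟩ := triv hcop h2
    apply Subtype.ext
    simp [S, T, Prod.ext_iff, pow_mul, hs, ht, pow_orderOf_eq_one]
  have hsurj : Function.Surjective p := by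
    rw [← MonoidHom.range_eq_top, eq_top_iff, ← hgen, Subgroup.closure_le]
    rintro x (rfl | hx)
    · exact ⟨⟨S, hS⟩, rfl⟩
    · rw [Set.mem_singleton_iff.1 hx]; exact ⟨⟨T, hT⟩, rfl⟩
  let E : K ≃* G := MulEquiv.ofBijective p ⟨hinj, hsurj⟩
  refine ⟨((MonoidHom.snd G H).comp K.subtype).comp E.symm.toMonoidHom, ?_, ?_⟩
  · have : E.symm σ = ⟨S, hS⟩ := by rw [MulEquiv.symm_apply_eq]; rfl
    simp [this, S]
  · have : E.symm τ = ⟨T, hT⟩ := by rw [MulEquiv.symm_apply_eq]; rfl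
    simp [this, T]

lemma hom_ext {G H : Type*} [Group G] [Group H] {σ τ : G}
    (hgen : Subgroup.closure {σ, τ} = ⊤) {f f' : G →* H} (h1 : f σ = f' σ) (h2 : f τ = f' τ) :
    f = f' := by
  apply MonoidHom.eq_of_eqOn_dense hgen
  rintro x (rfl | hx)
  · exact h1
  · rw [Set.mem_singleton_iff.1 hx]; exact h2

lemma aut_ext {G : Type*} [Group G] {σ τ : G}
    (hgen : Subgroup.closure {σ, τ} = ⊤) {f f' : MulAut G} (h1 : f σ = f' σ) (h2 : f τ = f' τ) :
    f = f' := by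
  have : f.toMonoidHom = f'.toMonoidHom := hom_ext hgen h1 h2
  ext x
  exact DFunLike.congr_fun this x

/-- the geometric sum facts -/
lemma arith {d e k : ℕ} (he : 0 < e) (hk : 0 < k)
    (hcop : Nat.Coprime d e) (hpow : (k : ZMod e) ^ d = 1) (hsf : Squarefree e) :
    (e ∣ Nat.gcd e (k - 1) * ∑ i ∈ Finset.range d, k ^ i) ∧
    (∀ b, e ∣ b * ∑ i ∈ Finset.range d, k ^ i → Nat.gcd e (k - 1) ∣ b) := by
  set N := ∑ i ∈ Finset.range d, k ^ i with hN
  set z := Nat.gcd e (k - 1) with hz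
  have hzpos : 0 < z := Nat.gcd_pos_of_pos_left _ he
  obtain ⟨g, hg⟩ : z ∣ e := Nat.gcd_dvd_left _ _
  have hmul : e ∣ (k - 1) * N := by
    rw [← ZMod.natCast_eq_zero_iff, hN]
    push_cast [Nat.cast_sub (show 1 ≤ k from hk)]
    rw [mul_geom_sum, hpow, sub_self]
  constructor
  · have hgk : Nat.Coprime g (k - 1) := by
      have hzg : Nat.Coprime z g := by
        rw [hg] at hsf
        exact Nat.coprime_of_squarefree_mul hsf
      have h1 : Nat.gcd g (k - 1) ∣ z :=
        Nat.dvd_gcd ((Nat.gcd_dvd_left _ _).trans ⟨z, by rw [hg, mul_comm]⟩) (Nat.gcd_dvd_right _ _)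
      exact Nat.eq_one_of_dvd_coprimes hzg h1 (Nat.gcd_dvd_left _ _)
    have : g ∣ N := hgk.dvd_of_dvd_mul_left ((Dvd.intro_left z hg.symm).trans hmul)
    conv_lhs => rw [hg]
    exact mul_dvd_mul_left z this
  · intro b hb
    have h1 : N ≡ d [MOD z] := by
      have hk1 : k ≡ 1 [MOD z] := by
        apply Nat.ModEq.symm
        rw [Nat.modEq_iff_dvd' hk]
        exact Nat.gcd_dvd_right _ _
      rw [← ZMod.natCast_eq_natCast_iff] at hk1 ⊢
      rw [hN]; push_cast; rw [hk1]; simp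
    have h2 : Nat.Coprime z N := by
      have : Nat.gcd N z = Nat.gcd d z := h1.gcd_eq
      rw [Nat.coprime_comm, Nat.Coprime, this]
      exact hcop.coprime_dvd_right (Nat.gcd_dvd_left _ _)
    exact h2.dvd_of_dvd_mul_right ((Nat.gcd_dvd_left _ _).trans hb)

/-- classification of automorphisms -/
lemma classify {G : Type*} [Group G] {σ τ : G} {d e k : ℕ} (hd : 0 < d) (he : 0 < e) (hk : 0 < k)
    (hcop : Nat.Coprime d e) (hord : orderOf (k : ZMod e) = d) (hsf : Squarefree e)
    (hσ : orderOf σ = e) (hτ : orderOf τ = d)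
    (hrel : τ * σ * τ⁻¹ = σ ^ k) (hgen : Subgroup.closure {σ, τ} = ⊤) (α : MulAut G) :
    ∃ s c : ℕ, Nat.Coprime s e ∧ α σ = σ ^ s ∧ α τ = σ ^ (Nat.gcd e (k - 1) * c) * τ := by
  have hσe : σ ^ e = 1 := by rw [← hσ]; exact pow_orderOf_eq_one σ
  have hτd : τ ^ d = 1 := by rw [← hτ]; exact pow_orderOf_eq_one τ
  have nf : ∀ x : G, ∃ a b : ℕ, x = σ ^ a * τ ^ b := fun x =>
    normal hd he hrel hσe hτd (by rw [hgen]; trivial)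
  have hcop' : Nat.Coprime (orderOf τ) (orderOf σ) := by rw [hσ, hτ]; exact hcop
  have hpow : (k : ZMod e) ^ d = 1 := by rw [← hord]; exact pow_orderOf_eq_one _
  obtain ⟨s, hs⟩ : ∃ s, α σ = σ ^ s := by
    obtain ⟨a, b, hab⟩ := nf (α σ)
    have h1 : (α σ) ^ e = 1 := by rw [← map_pow, hσe, map_one]
    obtain ⟨c, hc⟩ := powST' hrel a b e
    rw [hab, hc] at h1
    have h2 := (triv hcop' h1).2
    rw [hτ] at h2
    obtain ⟨m, rfl⟩ := hcop.dvd_of_dvd_mul_right h2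
    exact ⟨a, by rw [hab, pow_mul, hτd]; simp⟩
  have hsc : Nat.Coprime s e := by
    have h1 : orderOf (α σ) = orderOf σ := MulEquiv.orderOf_eq α σ
    have hfin : IsOfFinOrder σ := isOfFinOrder_iff_pow_eq_one.2 ⟨e, he, hσe⟩
    rw [hs, hfin.orderOf_pow, hσ] at h1
    have h2 := Nat.div_mul_cancel (Nat.gcd_dvd_left e s)
    rw [h1] at h2
    rw [Nat.coprime_comm]
    exact Nat.eq_of_mul_eq_mul_left he (by rw [h2, mul_one])
  obtain ⟨b, j, hbj⟩ := nf (α τ)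
  have hτj : τ ^ j = τ := by
    have h1 : α τ * α σ = (α σ) ^ k * α τ := by
      rw [← map_pow, ← map_mul, ← map_mul, ← hrel]; simp
    rw [hs, hbj, mul_assoc, push hrel, ← pow_mul, ← mul_assoc, ← mul_assoc, ← pow_add, ← pow_add,
      mul_left_inj, pow_eq_pow_iff_modEq, hσ, add_comm] at h1
    have h2 : s * k ^ j ≡ s * k [MOD e] := Nat.ModEq.add_right_cancel' b h1
    have h3 : k ^ j ≡ k [MOD e] := Nat.ModEq.cancel_left_of_coprime hsc.symm h2
    rw [← ZMod.natCast_eq_natCast_iff] at h3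
    push_cast at h3
    have h4 : (k : ZMod e) ^ (j + (d - 1)) = 1 := by
      rw [pow_add, h3, ← pow_succ', Nat.sub_add_cancel hd, hpow]
    have h5 := orderOf_dvd_of_pow_eq_one h4
    rw [hord, ← hτ, orderOf_dvd_iff_pow_eq_one, hτ, pow_add] at h5
    have h6 : τ * τ ^ (d - 1) = 1 := by rw [← pow_succ', Nat.sub_add_cancel hd, hτd]
    exact mul_right_cancel (h5.trans h6.symm)
  rw [hτj] at hbj
  have h7 : (α τ) ^ d = 1 := by rw [← map_pow, hτd, map_one]
  rw [hbj, powST hrel, hτd, mul_one, ← orderOf_dvd_iff_pow_eq_one, hσ] at h7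
  obtain ⟨c, rfl⟩ := (arith he hk hcop hpow hsf).2 b h7
  exact ⟨s, c, hsc, hs, hbj⟩

end GdekAux

/-- **Lemma (automorphisms of `G(d,e,k)`).** Let `G = G(d,e,k)` be of squarefree order
`n = d·e`, realised via generators `σ, τ`, and set `z = gcd(e,k-1)`, `g = e/z`. Then
`|Aut(G)| = g·φ(e)` and `Aut(G) ≅ C_g ⋊ U(e)` where `a ∈ U(e)` acts on `C_g` by
`x ↦ x^a`. Explicitly, `Aut(G)` is generated by `θ` (with `θ(σ) = σ`, `θ(τ) = σ^z τ`)
and the `φ_s` for `s ∈ U(e)` (with `φ_s(σ) = σ^s`, `φ_s(τ) = τ`), and these satisfy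
`θ^g = id`, `φ_s φ_t = φ_{st}` and `φ_s θ φ_s⁻¹ = θ^s`. -/
theorem automorphism_group_of_Gdek (d e k : ℕ) (hd : 0 < d) (he : 0 < e) (hk : 0 < k)
    (hcop : Nat.Coprime d e) (hord : orderOf (k : ZMod e) = d)
    (hsf : Squarefree (d * e))
    (G : Type) [Group G] (σ τ : G)
    (hσ : orderOf σ = e) (hτ : orderOf τ = d)
    (hrel : τ * σ * τ⁻¹ = σ ^ k) (hgen : Subgroup.closure {σ, τ} = ⊤)
    (z g : ℕ) (hz : z = Nat.gcd e (k - 1)) (hg : g = e / z) :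
    Nat.card (MulAut G) = g * Nat.totient e ∧
    (∃ φact : (ZMod e)ˣ →* MulAut (Multiplicative (ZMod g)),
      (∀ (a : (ZMod e)ˣ) (x : Multiplicative (ZMod g)), φact a x = x ^ ((a : ZMod e)).val) ∧
      Nonempty (MulAut G ≃* SemidirectProduct (Multiplicative (ZMod g)) (ZMod e)ˣ φact)) ∧
    (∃ (θ : MulAut G) (Φ : (ZMod e)ˣ → MulAut G),
      θ σ = σ ∧ θ τ = σ ^ z * τ ∧
      (∀ s : (ZMod e)ˣ, Φ s σ = σ ^ ((s : ZMod e)).val ∧ Φ s τ = τ) ∧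
      Subgroup.closure ({θ} ∪ Set.range Φ) = ⊤ ∧
      θ ^ g = 1 ∧
      (∀ s t : (ZMod e)ˣ, Φ s * Φ t = Φ (s * t)) ∧
      (∀ s : (ZMod e)ˣ, Φ s * θ * (Φ s)⁻¹ = θ ^ ((s : ZMod e)).val)) := by
  have hσe : σ ^ e = 1 := by rw [← hσ]; exact pow_orderOf_eq_one σ
  have hτd : τ ^ d = 1 := by rw [← hτ]; exact pow_orderOf_eq_one τ
  have hcop' : Nat.Coprime (orderOf τ) (orderOf σ) := by rw [hσ, hτ]; exact hcop
  have hpow : (k : ZMod e) ^ d = 1 := by rw [← hord]; exact pow_orderOf_eq_one _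
  have hsf' : Squarefree e := hsf.squarefree_of_dvd (Dvd.intro_left d rfl)
  have : NeZero e := ⟨he.ne'⟩
  have hzpos : 0 < z := by rw [hz]; exact Nat.gcd_pos_of_pos_left _ he
  have hzg : e = z * g := by
    rw [hg, Nat.mul_div_cancel']; rw [hz]; exact Nat.gcd_dvd_left _ _
  have hgpos : 0 < g := Nat.pos_of_mul_pos_left (hzg ▸ he)
  have : NeZero g := ⟨hgpos.ne'⟩
  have hge : g ∣ e := Dvd.intro_left z hzg.symm
  have hpw : ∀ (x : ZMod e) (n : ℕ), x = n → σ ^ x.val = σ ^ n := by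
    intro x n h
    rw [pow_eq_pow_iff_modEq, hσ, ← ZMod.natCast_eq_natCast_iff, ZMod.natCast_val, ZMod.cast_id, h]
  have mk := fun (s t : G) hs ht h => GdekAux.exists_hom (H := G) (by rw [hτ]; exact hd)
    (by rw [hσ]; exact he) hcop' hrel hgen s t hs ht h
  rw [hσ, hτ] at mk
  -- the automorphisms Φ
  obtain ⟨F, hF⟩ : ∃ F : (ZMod e)ˣ → (G →* G),
      ∀ s : (ZMod e)ˣ, F s σ = σ ^ (s : ZMod e).val ∧ F s τ = τ := by
    have : ∀ s : (ZMod e)ˣ, ∃ f : G →* G, f σ = σ ^ (s : ZMod e).val ∧ f τ = τ := by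
      intro s
      refine mk _ _ ?_ hτd ?_
      · rw [← pow_mul, mul_comm, pow_mul, hσe, one_pow]
      · rw [← conj_pow, hrel, ← pow_mul, ← pow_mul, mul_comm]
    exact ⟨fun s => (this s).choose, fun s => (this s).choose_spec⟩
  have hFmul : ∀ s t, (F s).comp (F t) = F (s * t) := by
    intro s t
    apply GdekAux.hom_ext hgen
    · rw [MonoidHom.comp_apply, (hF t).1, map_pow, (hF s).1, (hF _).1, ← pow_mul]
      refine (hpw _ _ ?_).symm
      simp
    · rw [MonoidHom.comp_apply, (hF t).2, (hF s).2, (hF _).2]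
  have hFone : F 1 = MonoidHom.id G := by
    apply GdekAux.hom_ext hgen
    · rw [(hF 1).1, hpw _ 1 (by simp)]; simp
    · rw [(hF 1).2]; simp
  obtain ⟨Φ, hΦ⟩ : ∃ Φ : (ZMod e)ˣ → MulAut G,
      ∀ s : (ZMod e)ˣ, Φ s σ = σ ^ (s : ZMod e).val ∧ Φ s τ = τ :=
    ⟨fun s => (F s).toMulEquiv (F s⁻¹) (by rw [hFmul, inv_mul_cancel, hFone])
      (by rw [hFmul, mul_inv_cancel, hFone]), fun s => hF s⟩
  have hΦmul : ∀ s t, Φ s * Φ t = Φ (s * t) := by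
    intro s t
    apply GdekAux.aut_ext hgen
    · rw [MulAut.mul_apply, (hΦ t).1, map_pow, (hΦ s).1, (hΦ _).1, ← pow_mul]
      refine (hpw _ _ ?_).symm
      simp
    · rw [MulAut.mul_apply, (hΦ t).2, (hΦ s).2, (hΦ _).2]
  -- the automorphism θ
  obtain ⟨T, hT⟩ : ∃ T : ℕ → (G →* G), ∀ c, T c σ = σ ∧ T c τ = σ ^ (z * c) * τ := by
    have : ∀ c : ℕ, ∃ f : G →* G, f σ = σ ∧ f τ = σ ^ (z * c) * τ := by
      intro c
      refine mk _ _ hσe ?_ ?_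
      · rw [GdekAux.powST hrel, hτd, mul_one, ← orderOf_dvd_iff_pow_eq_one, hσ, mul_right_comm]
        apply Dvd.dvd.mul_right
        rw [hz]
        exact (GdekAux.arith he hk hcop hpow hsf').1
      · rw [mul_inv_rev, mul_assoc, mul_assoc, ← mul_assoc σ, ← mul_assoc τ, ← mul_assoc τ, hrel,
          ← mul_assoc, ← pow_add, ← inv_pow, inv_pow, mul_inv_eq_iff_eq_mul, ← pow_add, add_comm]
    exact ⟨fun s => (this s).choose, fun s => (this s).choose_spec⟩
  have hTmul : ∀ c c', (T c).comp (T c') = T (c + c') := by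
    intro c c'
    apply GdekAux.hom_ext hgen
    · rw [MonoidHom.comp_apply, (hT c').1, (hT _).1, (hT _).1]
    · rw [MonoidHom.comp_apply, (hT c').2, map_mul, map_pow, (hT c).1, (hT c).2, (hT _).2,
        ← mul_assoc, ← pow_add, mul_add, add_comm]
  have hTg : T g = MonoidHom.id G := by
    apply GdekAux.hom_ext hgen
    · rw [(hT _).1]; rfl
    · rw [(hT _).2, ← hzg, hσe]; simp
  obtain ⟨θ, hθσ, hθτ⟩ : ∃ θ : MulAut G, θ σ = σ ∧ θ τ = σ ^ z * τ :=
    ⟨(T 1).toMulEquiv (T (g - 1)) (by rw [hTmul, Nat.sub_add_cancel hgpos, hTg])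
      (by rw [hTmul, Nat.add_sub_cancel' hgpos, hTg]), (hT 1).1, by
        have := (hT 1).2; rw [mul_one] at this; exact this⟩
  have hθpow : ∀ c : ℕ, (θ ^ c) σ = σ ∧ (θ ^ c) τ = σ ^ (z * c) * τ := by
    intro c
    induction c with
    | zero => simp
    | succ c ih =>
      rw [pow_succ, MulAut.mul_apply, MulAut.mul_apply, hθσ, hθτ, map_mul, map_pow, ih.1, ih.2]
      exact ⟨rfl, by rw [← mul_assoc, ← pow_add, mul_add, mul_one, add_comm]⟩
  have hθg : θ ^ g = 1 := by
    apply GdekAux.aut_ext hgen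
    · rw [(hθpow g).1]; rfl
    · rw [(hθpow g).2, ← hzg, hσe]; simp
  have hconj' : ∀ s : (ZMod e)ˣ, Φ s * θ = θ ^ (s : ZMod e).val * Φ s := by
    intro s
    apply GdekAux.aut_ext hgen
    · rw [MulAut.mul_apply, MulAut.mul_apply, hθσ, (hΦ s).1, map_pow, (hθpow _).1]
    · rw [MulAut.mul_apply, MulAut.mul_apply, hθτ, (hΦ s).2, map_mul, map_pow, (hθpow _).2,
        (hΦ s).1, (hΦ s).2, ← pow_mul, mul_comm z]
  have hconj : ∀ s : (ZMod e)ˣ, Φ s * θ * (Φ s)⁻¹ = θ ^ (s : ZMod e).val := by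
    intro s
    rw [hconj', mul_inv_cancel_right]
  have hsurj : ∀ α : MulAut G, ∃ (c : ℕ) (s : (ZMod e)ˣ), α = θ ^ c * Φ s := by
    intro α
    obtain ⟨s, c, hsc, h1, h2⟩ :=
      GdekAux.classify hd he hk hcop hord hsf' hσ hτ hrel hgen α
    refine ⟨c, ZMod.unitOfCoprime s hsc, ?_⟩
    apply GdekAux.aut_ext hgen
    · rw [MulAut.mul_apply, (hΦ _).1, map_pow, (hθpow _).1, h1]
      exact (hpw _ _ (by simp)).symm
    · rw [MulAut.mul_apply, (hΦ _).2, (hθpow _).2, h2, hz]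
  have hthird : Subgroup.closure ({θ} ∪ Set.range Φ) = ⊤ := by
    rw [eq_top_iff]
    rintro α -
    obtain ⟨c, s, rfl⟩ := hsurj α
    exact mul_mem (pow_mem (Subgroup.subset_closure (by simp)) _)
      (Subgroup.subset_closure (Or.inr ⟨s, rfl⟩))
  -- the semidirect product
  obtain ⟨φact, hφ⟩ : ∃ φact : (ZMod e)ˣ →* MulAut (Multiplicative (ZMod g)),
      ∀ (a : (ZMod e)ˣ) (x : Multiplicative (ZMod g)), φact a x = x ^ ((a : ZMod e)).val := by
    let A : (ZMod e)ˣ →* MulAut (Multiplicative (ZMod g)) :=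
      (MulAutMultiplicative (ZMod g)).symm.toMonoidHom.comp
        ((DistribMulAction.toAddAut (ZMod g)ˣ (ZMod g)).comp (ZMod.unitsMap hge))
    refine ⟨A, fun a x => ?_⟩
    apply Multiplicative.toAdd.injective
    have : Multiplicative.toAdd (A a x) =
      ((ZMod.unitsMap hge a : (ZMod g)ˣ) : ZMod g) * Multiplicative.toAdd x := rfl
    rw [this, toAdd_pow, nsmul_eq_mul, ZMod.natCast_val]
    rfl
  let f1 : Multiplicative (ZMod g) →* MulAut G :=
    { toFun := fun x => θ ^ (Multiplicative.toAdd x).val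
      map_one' := by simp
      map_mul' := by
        intro x y
        rw [← pow_add, toAdd_mul, ZMod.val_add]
        exact (pow_eq_pow_mod _ hθg).symm }
  let f2 : (ZMod e)ˣ →* MulAut G := MonoidHom.mk' Φ (fun s t => (hΦmul s t).symm)
  have hcompat : ∀ s : (ZMod e)ˣ, f1.comp (φact s).toMonoidHom =
      (MulAut.conj (f2 s)).toMonoidHom.comp f1 := by
    intro s
    refine MonoidHom.ext fun x => ?_
    change f1 (φact s x) = Φ s * (θ ^ (Multiplicative.toAdd x).val) * (Φ s)⁻¹
    rw [hφ, map_pow, ← conj_pow, hconj, ← pow_mul, mul_comm, pow_mul]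
    rfl
  let L := SemidirectProduct.lift f1 f2 hcompat
  have hL : ∀ p, L p = θ ^ (Multiplicative.toAdd p.left).val * Φ p.right := fun p => rfl
  have hLinj : Function.Injective L := by
    rw [injective_iff_map_eq_one]
    intro p hp
    rw [hL] at hp
    have h1 := DFunLike.congr_fun hp σ
    have h2 := DFunLike.congr_fun hp τ
    rw [MulAut.mul_apply, (hΦ _).1, map_pow, (hθpow _).1, MulAut.one_apply] at h1
    rw [MulAut.mul_apply, (hΦ _).2, (hθpow _).2, MulAut.one_apply, mul_eq_right,
      ← orderOf_dvd_iff_pow_eq_one, hσ] at h2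
    conv_lhs at h2 => rw [hzg]
    have h3 : g ∣ (Multiplicative.toAdd p.left).val := Nat.dvd_of_mul_dvd_mul_left hzpos h2
    have h4 : Multiplicative.toAdd p.left = 0 := by
      rw [← ZMod.natCast_eq_zero_iff, ZMod.natCast_val, ZMod.cast_id] at h3
      exact h3
    have h5 : p.right = 1 := by
      have : σ ^ (p.right : ZMod e).val = σ ^ 1 := by rw [h1, pow_one]
      rw [pow_eq_pow_iff_modEq, hσ, ← ZMod.natCast_eq_natCast_iff, ZMod.natCast_val, ZMod.cast_id]
        at this
      apply Units.ext
      simpa using this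
    exact SemidirectProduct.ext h4 h5
  have hLsurj : Function.Surjective L := by
    intro α
    obtain ⟨c, s, rfl⟩ := hsurj α
    refine ⟨⟨Multiplicative.ofAdd (c : ZMod g), s⟩, ?_⟩
    rw [hL]
    congr 1
    simp only [toAdd_ofAdd, ZMod.val_natCast]
    exact (pow_eq_pow_mod _ hθg).symm
  let E := MulEquiv.ofBijective L ⟨hLinj, hLsurj⟩
  refine ⟨?_, ⟨φact, hφ, ⟨E.symm⟩⟩, θ, Φ, hθσ, hθτ, hΦ, hthird, hθg, hΦmul, hconj⟩
  rw [← Nat.card_congr E.toEquiv, Nat.card_congr SemidirectProduct.equivProd, Nat.card_prod,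
    Nat.card_eq_fintype_card (α := (ZMod e)ˣ), ZMod.card_units_eq_totient]
  congr 1
  exact Nat.card_zmod g
end

section
/- Let G = G(d,e,k) be a group of squarefree order n = d·e, with z = gcd(e,k−1) and g = e/z. Then the number of cyclic subgroups of Hol(G) = G ⋊ Aut(G) that act regularly on G is exactly 2^{ω(g)} · g, where ω(g) is the number of distinct prime factors of g. -/
/-- The holomorph `Hol(G) = G ⋊ Aut(G)`. -/
abbrev Hol (G : Type*) [Group G] : Type _ :=
  SemidirectProduct G (MulAut G) (MonoidHom.id (MulAut G))

/-- A subgroup `C ≤ Hol(G)` is regular for the action `[α,ψ]·β = α·ψ(β)` of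
`Hol(G)` on `G`: transitive with trivial point stabilisers. -/
def IsRegularHolSubgroup (G : Type*) [Group G] (C : Subgroup (Hol G)) : Prop :=
  (∀ x y : G, ∃ h ∈ C, h.left * h.right x = y) ∧
    ∀ h ∈ C, ∀ x : G, h.left * h.right x = x → h = 1

/-- `h` generates a transitive group. -/
def HT {G : Type*} [Group G] (h : Hol G) : Prop := ∀ y : G, ∃ m : ℕ, (h ^ m).left = y

theorem hol_act_mul {G : Type*} [Group G] (h h' : Hol G) (x : G) :
    (h * h').left * (h * h').right x = h.left * h.right (h'.left * h'.right x) := by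
  simp [mul_assoc]

theorem hol_inj {G : Type*} [Group G] (h h' : Hol G)
    (H : ∀ x, h.left * h.right x = h'.left * h'.right x) : h = h' := by
  have h1 : h.left = h'.left := by simpa using H 1
  refine SemidirectProduct.ext h1 ?_
  ext x
  have := H x
  rw [h1] at this
  exact mul_left_cancel this

theorem HT_iff {G : Type*} [Group G] [Finite G] (h : Hol G) :
    HT h ↔ IsRegularHolSubgroup G (Subgroup.zpowers h) := by
  have : Finite (Hol G) := Finite.of_equiv _ SemidirectProduct.equivProd.symm
  constructor
  · intro H
    have tr : ∀ x y : G, ∃ c ∈ Subgroup.zpowers h, c.left * c.right x = y := by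
      intro x y
      obtain ⟨i, hi⟩ := H x
      obtain ⟨j, hj⟩ := H y
      refine ⟨h ^ j * (h ^ i)⁻¹, ?_, ?_⟩
      · exact mul_mem (Subgroup.npow_mem_zpowers h j) (inv_mem (Subgroup.npow_mem_zpowers h i))
      · have hx : x = (h ^ i).left * (h ^ i).right 1 := by simp [hi]
        rw [hx, ← hol_act_mul]
        simp [hj]
    refine ⟨tr, ?_⟩
    intro c hc x hx
    refine hol_inj _ _ ?_
    intro y
    obtain ⟨c', hc', hy⟩ := tr x y
    have comm : c * c' = c' * c := by
      obtain ⟨i, rfl⟩ := hc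
      obtain ⟨j, rfl⟩ := hc'
      exact ((Commute.refl h).zpow_zpow i j).eq
    rw [← hy, ← hol_act_mul, comm, hol_act_mul, hx]
    simp
  · rintro ⟨tr, -⟩ y
    obtain ⟨c, hc, hy⟩ := tr 1 y
    rw [← mem_powers_iff_mem_zpowers] at hc
    obtain ⟨m, rfl⟩ := hc
    exact ⟨m, by simpa using hy⟩

theorem regular_card {G : Type*} [Group G] (C : Subgroup (Hol G))
    (hC : IsRegularHolSubgroup G C) : Nat.card C = Nat.card G := by
  refine Nat.card_congr (Equiv.ofBijective (fun c : C => (c : Hol G).left) ⟨?_, ?_⟩)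
  · intro c c' hcc
    have h1 : ((c' : Hol G)⁻¹ * c) = 1 := by
      refine hC.2 _ (mul_mem (inv_mem c'.2) c.2) 1 ?_
      have hcc' : (c : Hol G).left = (c' : Hol G).left := hcc
      simp [hcc']
    exact Subtype.ext (inv_mul_eq_one.mp h1).symm
  · intro y
    obtain ⟨c, hc, hy⟩ := hC.1 1 y
    exact ⟨⟨c, hc⟩, by simpa using hy⟩

theorem card_gens {H : Type*} [Group H] [Finite H] (C : Subgroup H) (hC : IsCyclic C) :
    Nat.card {h : H // Subgroup.zpowers h = C} = Nat.totient (Nat.card C) := by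
  classical
  have := Fintype.ofFinite C
  have key := IsCyclic.card_orderOf_eq_totient (α := C) (d := Fintype.card C) (dvd_refl _)
  rw [Nat.card_eq_fintype_card (α := C), ← key, ← Fintype.card_coe, ← Nat.card_eq_fintype_card]
  have mem : ∀ h : H, Subgroup.zpowers h = C → h ∈ C := fun h hh => by
    rw [← hh]; exact Subgroup.mem_zpowers h
  have ord : ∀ h : H, ∀ hh : h ∈ C, (Subgroup.zpowers h = C ↔
      orderOf (⟨h, hh⟩ : C) = Fintype.card C) := by
    intro h hh
    rw [Subgroup.orderOf_mk, ← Nat.card_zpowers, ← Nat.card_eq_fintype_card]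
    constructor
    · intro h1; rw [h1]
    · intro h1
      refine Subgroup.eq_of_le_of_card_ge ?_ h1.ge
      simpa using hh
  exact Nat.card_congr
    ⟨fun h => ⟨⟨h.1, mem _ h.2⟩, by simpa using (ord _ (mem _ h.2)).mp h.2⟩,
     fun c => ⟨c.1.1, (ord c.1.1 c.1.2).mpr (Finset.mem_filter.mp c.2).2⟩,
     fun _ => rfl, fun _ => rfl⟩

theorem card_HT {G : Type*} [Group G] [Finite G] :
    Nat.card {h : Hol G // HT h} =
      Nat.card {C : Subgroup (Hol G) // IsCyclic C ∧ IsRegularHolSubgroup G C} *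
        Nat.totient (Nat.card G) := by
  classical
  have : Finite (Hol G) := Finite.of_equiv _ SemidirectProduct.equivProd.symm
  let f : {h : Hol G // HT h} → {C : Subgroup (Hol G) // IsCyclic C ∧ IsRegularHolSubgroup G C} :=
    fun h => ⟨Subgroup.zpowers h.1, inferInstance, (HT_iff _).mp h.2⟩
  have := Fintype.ofFinite {C : Subgroup (Hol G) // IsCyclic C ∧ IsRegularHolSubgroup G C}
  rw [← Nat.card_congr (Equiv.sigmaFiberEquiv f), Nat.card_sigma]
  rw [Finset.sum_congr rfl (g := fun _ => Nat.totient (Nat.card G))]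
  · rw [Finset.sum_const, Finset.card_univ, smul_eq_mul,
      Nat.card_eq_fintype_card (α := {C : Subgroup (Hol G) // _})]
  · intro C _
    rw [← regular_card C.1 C.2.2, ← card_gens C.1 C.2.1]
    refine Nat.card_congr ⟨fun h => ⟨h.1.1, congrArg Subtype.val h.2⟩,
      fun h => ⟨⟨h.1, (HT_iff _).mpr (by rw [h.2]; exact C.2.2)⟩, Subtype.ext h.2⟩,
      fun _ => rfl, fun _ => rfl⟩

/-- Coordinates on a group `G = R ⋊ Z/d` with `R` a product of prime fields. -/
structure Coord (G : Type*) [Group G] (e d : ℕ) {ι : Type*} (p : ι → ℕ) where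
  X : G → (∀ i, ZMod (p i))
  Y : G → ZMod d
  K : ZMod d → (∀ i, ZMod (p i))
  hX : ∀ g h, X (g * h) = X g + K (Y g) * X h
  hY : ∀ g h, Y (g * h) = Y g + Y h
  hK : ∀ a b, K (a + b) = K a * K b
  K0 : K 0 = 1
  Kinj : Function.Injective K
  bij : Function.Bijective (fun g => (X g, Y g))
  he : (e : ∀ i, ZMod (p i)) = 0
  cop : Nat.Coprime e d
  intsurj : Function.Surjective (Int.cast : ℤ → ∀ i, ZMod (p i))
  hpd : ∀ i, Nat.Coprime (p i) d
  hdvd : ∀ m : ℕ, (∀ i, p i ∣ m) → d ∣ m → Nat.card G ∣ m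

namespace Coord
variable {G : Type*} [Group G] {e d : ℕ} {ι : Type*} {p : ι → ℕ} (D : Coord G e d p)

theorem X1 : D.X 1 = 0 := by
  have h := D.hX 1 1
  have hy : D.Y 1 = 0 := by simpa using D.hY 1 1
  rw [hy, D.K0] at h
  simpa using h

theorem Y1 : D.Y 1 = 0 := by simpa using D.hY 1 1

theorem ext {g h : G} (h1 : D.X g = D.X h) (h2 : D.Y g = D.Y h) : g = h :=
  D.bij.1 (Prod.ext h1 h2)

theorem exE (x : ∀ i, ZMod (p i)) (y : ZMod d) : ∃ g, D.X g = x ∧ D.Y g = y := by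
  obtain ⟨g, hg⟩ := D.bij.2 (x, y)
  exact ⟨g, congrArg Prod.fst hg, congrArg Prod.snd hg⟩

theorem Ypow (g : G) (m : ℕ) : D.Y (g ^ m) = m * D.Y g := by
  induction m with
  | zero => simp [D.Y1]
  | succ m ih => rw [pow_succ, D.hY, ih]; push_cast; ring

theorem Xpow (g : G) (hg : D.Y g = 0) (m : ℕ) : D.X (g ^ m) = m * D.X g := by
  induction m with
  | zero => simp [D.X1]
  | succ m ih => rw [pow_succ, D.hX, ih, D.Ypow, hg, mul_zero, D.K0]; push_cast; ring

theorem Kmul (m : ℕ) (b : ZMod d) : D.K (m * b) = D.K b ^ m := by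
  induction m with
  | zero => simp [D.K0]
  | succ m ih => push_cast; rw [add_mul, one_mul, D.hK, ih, pow_succ]

theorem Kne [∀ i, Fact (p i).Prime] (b : ZMod d) (i : ι) : D.K b i ≠ 0 := by
  intro h
  have h1 := D.hK b (-b)
  rw [add_neg_cancel, D.K0] at h1
  have := congrFun h1 i
  simp [h] at this

theorem K_one_of [NeZero d] {i : ι} {b : ZMod d} (hb : IsUnit b) (h : D.K b i = 1) (y : ZMod d) :
    D.K y i = 1 := by
  obtain ⟨c, hc⟩ := hb.exists_left_inv
  have : y = ((y * c).val : ℕ) * b := by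
    rw [ZMod.natCast_val, ZMod.cast_id', id, mul_assoc, hc, mul_one]
  rw [this, D.Kmul, Pi.pow_apply, h, one_pow]

theorem Y_aut_zero (ψ : MulAut G) (g : G) (hg : D.Y g = 0) : D.Y (ψ g) = 0 := by
  have h1 : g ^ e = 1 := by
    apply D.ext
    · rw [D.Xpow g hg, D.he, zero_mul, D.X1]
    · rw [D.Ypow, hg, mul_zero, D.Y1]
  have h2 : (e : ZMod d) * D.Y (ψ g) = 0 := by
    rw [← D.Ypow, ← map_pow, h1, map_one, D.Y1]
  have hu : IsUnit (e : ZMod d) := (ZMod.isUnit_iff_coprime e d).mpr D.cop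
  exact (hu.mul_right_eq_zero).mp h2

theorem additive_lin (D : Coord G e d p) (f : (∀ i, ZMod (p i)) → (∀ i, ZMod (p i)))
    (hf : ∀ x y, f (x + y) = f x + f y) (x : ∀ i, ZMod (p i)) : f x = x * f 1 := by
  let F : (∀ i, ZMod (p i)) →+ (∀ i, ZMod (p i)) := AddMonoidHom.mk' f hf
  obtain ⟨n, rfl⟩ := D.intsurj x
  have h := map_zsmul F n 1
  have h2 : (n • (1 : ∀ i, ZMod (p i))) = (n : ∀ i, ZMod (p i)) := by simp
  rw [h2, zsmul_eq_mul] at h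
  exact h

/-- classification of automorphisms -/
theorem aut_form [NeZero d] [∀ i, Fact (p i).Prime] (ψ : MulAut G) :
    ∃ s r : ∀ i, ZMod (p i), (∀ i, s i ≠ 0) ∧ (∀ i, D.K 1 i = 1 → r i = 0) ∧
      (∀ g, D.X (ψ g) = s * D.X g + r * (1 - D.K (D.Y g))) ∧ ∀ g, D.Y (ψ g) = D.Y g := by
  classical
  choose E EX EY using D.exE
  have hf : ∀ x y, D.X (ψ (E (x + y) 0)) = D.X (ψ (E x 0)) + D.X (ψ (E y 0)) := by
    intro x y
    have : E (x + y) 0 = E x 0 * E y 0 := by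
      apply D.ext
      · rw [D.hX, EX, EX, EX, EY, D.K0, one_mul]
      · rw [D.hY, EY, EY, EY, add_zero]
    rw [this, map_mul, D.hX, D.Y_aut_zero ψ _ (EY _ _), D.K0, one_mul]
  obtain ⟨s, hs⟩ : ∃ s, s = D.X (ψ (E 1 0)) := ⟨_, rfl⟩
  have hlin : ∀ x, D.X (ψ (E x 0)) = x * s := by
    intro x; rw [hs]; exact D.additive_lin (fun x => D.X (ψ (E x 0))) hf x
  have hE0 : E 0 0 = 1 := D.ext (by rw [EX, D.X1]) (by rw [EY, D.Y1])
  have hs0 : ∀ i, s i ≠ 0 := by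
    intro i hi
    have h1 : Pi.single i 1 * s = 0 := by
      ext j
      by_cases hj : j = i
      · subst hj; simp [hi]
      · simp [hj]
    have h2 : ψ (E (Pi.single i 1) 0) = 1 := by
      apply D.ext
      · rw [hlin, h1, D.X1]
      · rw [D.Y_aut_zero ψ _ (EY _ _), D.Y1]
    have h3 : E (Pi.single i 1) 0 = 1 := by simpa using h2
    have h4 := EX (Pi.single i 1) 0
    rw [h3, D.X1] at h4
    have := congrFun h4 i
    simp at this
  have hYψ : ∀ g, D.Y (ψ g) = D.Y g := by
    intro g
    have h1 : g * E 1 0 = E (D.K (D.Y g)) 0 * g := by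
      apply D.ext
      · rw [D.hX, D.hX, EX, EX, EY, D.K0]; ring
      · rw [D.hY, D.hY, EY, EY]; ring
    have h2 := congrArg (fun t => D.X (ψ t)) h1
    simp only [map_mul, D.hX] at h2
    rw [hlin, hlin, D.Y_aut_zero ψ _ (EY _ _), D.K0] at h2
    apply D.Kinj
    ext i
    have h3 := congrFun h2 i
    simp only [Pi.add_apply, Pi.mul_apply, one_mul] at h3
    have h4 : D.K (D.Y (ψ g)) i * s i = D.K (D.Y g) i * s i := by linear_combination h3
    exact mul_right_cancel₀ (hs0 i) h4
  have hτX : ∀ m : ℕ, D.X (E 0 1 ^ m) = 0 := by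
    intro m
    induction m with
    | zero => simp [D.X1]
    | succ m ih => rw [pow_succ, D.hX, ih, EX]; simp
  have hτd : E 0 1 ^ d = 1 := by
    apply D.ext
    · rw [hτX, D.X1]
    · rw [D.Ypow, D.Y1]; simp
  obtain ⟨c, hc⟩ : ∃ c, c = D.X (ψ (E 0 1)) := ⟨_, rfl⟩
  have hc0 : ∀ i, D.K 1 i = 1 → c i = 0 := by
    intro i hi
    have h1 : ∀ m : ℕ, D.X (ψ (E 0 1) ^ m) i = m * c i := by
      intro m
      induction m with
      | zero => simp [D.X1]
      | succ m ih =>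
        rw [pow_succ, D.hX, Pi.add_apply, Pi.mul_apply, ih, D.K_one_of isUnit_one hi, hc]
        push_cast; ring
    have h2 := h1 d
    rw [← map_pow, hτd, map_one, D.X1] at h2
    have hu : IsUnit (d : ZMod (p i)) := (ZMod.isUnit_iff_coprime d (p i)).mpr (D.hpd i).symm
    exact (hu.mul_right_eq_zero).mp h2.symm
  refine ⟨s, fun i => c i * (1 - D.K 1 i)⁻¹, hs0, ?_, ?_, hYψ⟩
  · intro i hi
    simp [hi]
  · obtain ⟨r, hr⟩ : ∃ r : ∀ i, ZMod (p i), r = fun i => c i * (1 - D.K 1 i)⁻¹ := ⟨_, rfl⟩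
    rw [← hr]
    have hrc : r * (1 - D.K 1) = c := by
      ext i
      simp only [hr, Pi.mul_apply, Pi.sub_apply, Pi.one_apply]
      by_cases hi : D.K 1 i = 1
      · simp [hi, hc0 i hi]
      · have : 1 - D.K 1 i ≠ 0 := fun h => hi (sub_eq_zero.mp h).symm
        field_simp
    have mulc : ∀ g h, D.X (ψ g) = s * D.X g + r * (1 - D.K (D.Y g)) →
        D.X (ψ h) = s * D.X h + r * (1 - D.K (D.Y h)) →
        D.X (ψ (g * h)) = s * D.X (g * h) + r * (1 - D.K (D.Y (g * h))) := by
      intro g h h1 h2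
      rw [map_mul, D.hX, D.hX, D.hY, D.hK, h1, h2, hYψ]
      ring
    have hpow : ∀ m : ℕ, D.X (ψ (E 0 1 ^ m)) =
        s * D.X (E 0 1 ^ m) + r * (1 - D.K (D.Y (E 0 1 ^ m))) := by
      intro m
      induction m with
      | zero => simp [D.X1, D.Y1, D.K0]
      | succ m ih =>
        rw [pow_succ]
        refine mulc _ _ ih ?_
        rw [EX, EY, ← hc, hrc]; simp
    intro g
    have hg : g = E (D.X g) 0 * E 0 1 ^ (D.Y g).val := by
      apply D.ext
      · rw [D.hX, EX, hτX]; simp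
      · rw [D.hY, EY, D.Ypow, EY]; simp
    rw [hg]
    refine mulc _ _ ?_ (hpow _)
    rw [hlin, EX, EY, D.K0]
    ring

theorem aut_exists [Finite G] [∀ i, Fact (p i).Prime] (s r : ∀ i, ZMod (p i))
    (hs : ∀ i, s i ≠ 0) : ∃ ψ : MulAut G,
      (∀ g, D.X (ψ g) = s * D.X g + r * (1 - D.K (D.Y g))) ∧ ∀ g, D.Y (ψ g) = D.Y g := by
  choose E EX EY using D.exE
  let f : G →* G := MonoidHom.mk'
    (fun g => E (s * D.X g + r * (1 - D.K (D.Y g))) (D.Y g)) (by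
      intro g h
      apply D.ext
      · simp only [D.hX, EX, EY, D.hY, D.hK]; ring
      · simp only [D.hY, EY])
  have fX : ∀ g, D.X (f g) = s * D.X g + r * (1 - D.K (D.Y g)) := fun g => EX _ _
  have fY : ∀ g, D.Y (f g) = D.Y g := fun g => EY _ _
  have hinj : Function.Injective f := by
    intro g h hgh
    have hy : D.Y g = D.Y h := by rw [← fY g, ← fY h, hgh]
    refine D.ext ?_ hy
    have hx := fX g
    rw [hgh, fX, hy] at hx
    ext i
    have := congrFun (add_right_cancel hx) i
    exact (mul_left_cancel₀ (hs i) this).symm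
  exact ⟨MulEquiv.ofBijective f (Finite.injective_iff_bijective.mp hinj), fX, fY⟩

/-- `h` has coordinates `(b, (a, s, r))`. -/
def Rel (h : Hol G) (q : ZMod d × (∀ i, ZMod (p i) × ZMod (p i) × ZMod (p i))) : Prop :=
  D.Y h.left = q.1 ∧ (∀ i, D.X h.left i = (q.2 i).1) ∧
  (∀ g i, D.X (h.right g) i = (q.2 i).2.1 * D.X g i + (q.2 i).2.2 * (1 - D.K (D.Y g) i)) ∧
  (∀ g, D.Y (h.right g) = D.Y g)

def Valid (q : ZMod d × (∀ i, ZMod (p i) × ZMod (p i) × ZMod (p i))) : Prop :=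
  ∀ i, (q.2 i).2.1 ≠ 0 ∧ (D.K 1 i = 1 → (q.2 i).2.2 = 0)

def LGood (b : ZMod d) (i : ι) (t : ZMod (p i) × ZMod (p i) × ZMod (p i)) : Prop :=
  (D.K 1 i = 1 ∧ t.1 ≠ 0 ∧ t.2.1 = 1 ∧ t.2.2 = 0) ∨
  (D.K 1 i ≠ 1 ∧ ((D.K b i * t.2.1 = 1 ∧ t.1 + D.K b i * t.2.2 ≠ 0) ∨ (t.2.1 = 1 ∧ t.2.2 ≠ 0)))

def Good (q : ZMod d × (∀ i, ZMod (p i) × ZMod (p i) × ZMod (p i))) : Prop :=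
  IsUnit q.1 ∧ ∀ i, D.LGood q.1 i (q.2 i)

theorem Good.valid {D : Coord G e d p} [∀ i, Fact (p i).Prime]
    {q : ZMod d × (∀ i, ZMod (p i) × ZMod (p i) × ZMod (p i))} (h : D.Good q) : D.Valid q := by
  intro i
  rcases h.2 i with ⟨h1, h2, h3, h4⟩ | ⟨h1, ⟨h2, h3⟩ | ⟨h2, h3⟩⟩
  · exact ⟨by rw [h3]; exact one_ne_zero, fun _ => h4⟩
  · refine ⟨?_, fun h => absurd h h1⟩
    intro h0
    rw [h0, mul_zero] at h2
    exact zero_ne_one h2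
  · exact ⟨by rw [h2]; exact one_ne_zero, fun h => absurd h h1⟩

theorem rel_ex [NeZero d] [∀ i, Fact (p i).Prime] (h : Hol G) : ∃ q, D.Valid q ∧ D.Rel h q := by
  obtain ⟨s, r, h1, h2, h3, h4⟩ := D.aut_form h.right
  refine ⟨(D.Y h.left, fun i => (D.X h.left i, s i, r i)), fun i => ⟨h1 i, h2 i⟩,
    rfl, fun i => rfl, ?_, h4⟩
  intro g i
  rw [h3]
  simp

theorem rel_ex' [Finite G] [∀ i, Fact (p i).Prime]
    (q : ZMod d × (∀ i, ZMod (p i) × ZMod (p i) × ZMod (p i))) (hq : D.Valid q) :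
    ∃ h, D.Rel h q := by
  obtain ⟨ψ, h1, h2⟩ := D.aut_exists (fun i => (q.2 i).2.1) (fun i => (q.2 i).2.2)
    (fun i => (hq i).1)
  obtain ⟨g, h3, h4⟩ := D.exE (fun i => (q.2 i).1) q.1
  refine ⟨⟨g, ψ⟩, h4, fun i => congrFun h3 i, ?_, h2⟩
  intro g i
  simp only [h1]
  simp

theorem rel_inj {h h' : Hol G} {q : ZMod d × (∀ i, ZMod (p i) × ZMod (p i) × ZMod (p i))}
    (H : D.Rel h q) (H' : D.Rel h' q) : h = h' := by
  apply SemidirectProduct.ext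
  · apply D.ext
    · ext i; rw [H.2.1, H'.2.1]
    · rw [H.1, H'.1]
  · ext g
    apply D.ext
    · ext i; rw [H.2.2.1, H'.2.2.1]
    · rw [H.2.2.2, H'.2.2.2]

theorem rel_inj' [∀ i, Fact (p i).Prime] {h : Hol G}
    {q q' : ZMod d × (∀ i, ZMod (p i) × ZMod (p i) × ZMod (p i))}
    (v : D.Valid q) (v' : D.Valid q') (H : D.Rel h q) (H' : D.Rel h q') : q = q' := by
  refine Prod.ext (by rw [← H.1, ← H'.1]) (funext fun i => ?_)
  have e1 : (q.2 i).1 = (q'.2 i).1 := by rw [← H.2.1, ← H'.2.1]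
  have e2 : (q.2 i).2.1 = (q'.2 i).2.1 := by
    obtain ⟨g, hg, hg'⟩ := D.exE 1 0
    have h1 := H.2.2.1 g i
    rw [H'.2.2.1 g i, hg, hg', D.K0] at h1
    simpa using h1.symm
  have e3 : (q.2 i).2.2 = (q'.2 i).2.2 := by
    obtain ⟨g, hg, hg'⟩ := D.exE 0 1
    have h1 := H.2.2.1 g i
    rw [H'.2.2.1 g i, hg, hg'] at h1
    by_cases hi : D.K 1 i = 1
    · rw [(v i).2 hi, (v' i).2 hi]
    · have h2 : 1 - D.K 1 i ≠ 0 := fun h => hi (sub_eq_zero.mp h).symm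
      simp only [Pi.zero_apply, mul_zero, zero_add] at h1
      exact (mul_right_cancel₀ h2 h1).symm
  exact Prod.ext e1 (Prod.ext e2 e3)

theorem pow_left_succ (h : Hol G) (m : ℕ) :
    (h ^ (m + 1)).left = h.left * h.right ((h ^ m).left) := by
  rw [pow_succ']
  simp

/-- necessity: an affine equivariant function forces a nonzero translation -/
theorem nec {F : Type*} [Field F] (h : Hol G) (hT : HT h) (w : G → F)
    (hw : Function.Surjective w) (μ ν : F) (hμ : μ ≠ 0)
    (H : ∀ g, w (h.left * h.right g) = μ * w g + ν) : μ = 1 ∧ ν ≠ 0 := by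
  have key : ∀ w0 : F, w0 = μ * w0 + ν → False := by
    intro w0 h0
    have h1 : ∀ m : ℕ, w ((h ^ m).left) - w0 = μ ^ m * (w 1 - w0) := by
      intro m
      induction m with
      | zero => simp
      | succ m ih => rw [pow_left_succ, H, pow_succ]; linear_combination μ * ih - h0
    by_cases h2 : w 1 - w0 = 0
    · obtain ⟨g, hg⟩ := hw (w0 + 1)
      obtain ⟨m, rfl⟩ := hT g
      have := h1 m
      rw [hg, h2] at this
      simp at this
    · obtain ⟨g, hg⟩ := hw w0
      obtain ⟨m, rfl⟩ := hT g
      have := h1 m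
      rw [hg, sub_self] at this
      exact mul_ne_zero (pow_ne_zero m hμ) h2 this.symm
  have hμ1 : μ = 1 := by
    by_contra hne
    have : 1 - μ ≠ 0 := fun h => hne (sub_eq_zero.mp h).symm
    apply key (ν / (1 - μ))
    field_simp
    ring
  refine ⟨hμ1, fun hν => key 0 ?_⟩
  rw [hν]; simp

/-- sufficiency -/
theorem suf [Finite G] (h : Hol G)
    (H : ∀ m : ℕ, (h ^ m).left = 1 → Nat.card G ∣ m) : HT h := by
  classical
  have inj : Function.Injective (fun m : Fin (Nat.card G) => (h ^ (m : ℕ)).left) := by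
    have aux : ∀ i j : ℕ, i ≤ j → j < Nat.card G → (h ^ i).left = (h ^ j).left → i = j := by
      intro i j hij hj hh
      obtain ⟨l, rfl⟩ := Nat.exists_eq_add_of_le hij
      rw [pow_add] at hh
      have h1 : (h ^ l).left = 1 := by simpa using hh
      have := Nat.eq_zero_of_dvd_of_lt (H l h1) (by omega)
      omega
    intro i j hij
    rcases le_total (i : ℕ) j with hl | hl
    · exact Fin.ext (aux i j hl j.2 hij)
    · exact Fin.ext (aux j i hl i.2 hij.symm).symm
  have bij := (Nat.bijective_iff_injective_and_card _).mpr ⟨inj, by simp⟩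
  intro y
  obtain ⟨m, hm⟩ := bij.2 y
  exact ⟨m, hm⟩

theorem transl {F : Type*} [Field F] (h : Hol G) (w : G → F) (ν : F)
    (H : ∀ g, w (h.left * h.right g) = w g + ν) (m : ℕ) : w ((h ^ m).left) = w 1 + m * ν := by
  induction m with
  | zero => simp
  | succ m ih => rw [pow_left_succ, H, ih]; push_cast; ring

theorem Y_pow (h : Hol G) (q) (hq : D.Rel h q) (m : ℕ) : D.Y ((h ^ m).left) = m * q.1 := by
  induction m with
  | zero => simp [D.Y1]
  | succ m ih => rw [pow_left_succ, D.hY, hq.2.2.2, ih, hq.1]; push_cast; ring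

/-- existence of the affine function, and its translation criterion -/
theorem exists_w [NeZero d] [∀ i, Fact (p i).Prime] (h : Hol G) (q) (hv : D.Valid q)
    (hq : D.Rel h q) (hb : IsUnit q.1) (i : ι) :
    ∃ (w : G → ZMod (p i)) (μ ν : ZMod (p i)), Function.Surjective w ∧ μ ≠ 0 ∧
      (∀ g, w (h.left * h.right g) = μ * w g + ν) ∧
      ((μ = 1 ∧ ν ≠ 0) ↔ D.LGood q.1 i (q.2 i)) := by
  obtain ⟨h1, h2, h3, h4⟩ := hq
  obtain ⟨b, f⟩ := q
  obtain ⟨hvs, hvr⟩ := hv i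
  have hk0 := D.Kne b i
  have hXf : ∀ g, D.X (h.left * h.right g) i = (f i).1 + D.K b i *
      ((f i).2.1 * D.X g i + (f i).2.2 * (1 - D.K (D.Y g) i)) := by
    intro g
    rw [D.hX, Pi.add_apply, Pi.mul_apply, h2, h1, h3]
  have hYf : ∀ g, D.K (D.Y (h.left * h.right g)) i = D.K b i * D.K (D.Y g) i := by
    intro g
    rw [D.hY, h1, h4, D.hK, Pi.mul_apply]
  have hsurj : ∀ x : ZMod (p i), ∃ g, D.X g i = x ∧ D.K (D.Y g) i = 1 := by
    intro x
    obtain ⟨n, hn⟩ := ZMod.intCast_surjective x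
    obtain ⟨g, hg, hg'⟩ := D.exE (n : ∀ i, ZMod (p i)) 0
    exact ⟨g, by rw [hg, ← hn]; simp, by rw [hg', D.K0]; rfl⟩
  unfold LGood
  simp only at h1 h2 h3 hb hvs hvr ⊢
  generalize (f i).1 = a at *
  generalize (f i).2.1 = s at *
  generalize (f i).2.2 = r at *
  by_cases hk : D.K 1 i = 1
  · have hkb := D.K_one_of isUnit_one hk
    refine ⟨fun g => D.X g i, s, a, fun x => (hsurj x).imp fun g hg => hg.1, hvs, ?_, ?_⟩
    · intro g
      simp only [hXf, hkb]; ring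
    · have := hvr hk
      tauto
  · have hkb : D.K b i ≠ 1 := fun h => hk (D.K_one_of hb h 1)
    by_cases ht : s = 1
    · -- t = k^b
      subst ht
      have hk1 : 1 - D.K b i ≠ 0 := fun h => hkb (sub_eq_zero.mp h).symm
      obtain ⟨α, hα⟩ : ∃ α, α * (1 - D.K b i) = a + D.K b i * r :=
        ⟨(a + D.K b i * r) / (1 - D.K b i), by field_simp⟩
      refine ⟨fun g => (D.X g i - α) * (D.K (D.Y g) i)⁻¹, 1, -r, ?_, one_ne_zero, ?_, ?_⟩
      · intro x
        obtain ⟨g, hg, hg'⟩ := hsurj (x + α)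
        exact ⟨g, by simp [hg, hg']⟩
      · intro g
        have := D.Kne (D.Y g) i
        simp only [hXf, hYf]
        field_simp
        linear_combination -hα
      · simp [hk, hkb]
    · have hk1 : D.K b i * (1 - s) ≠ 0 :=
        mul_ne_zero hk0 (fun h => ht (sub_eq_zero.mp h).symm)
      obtain ⟨β, hβ⟩ : ∃ β, β * (D.K b i * (1 - s)) = - (D.K b i * r) :=
        ⟨- (D.K b i * r) / (D.K b i * (1 - s)), div_mul_cancel₀ _ hk1⟩
      refine ⟨fun g => D.X g i - β * D.K (D.Y g) i, D.K b i * s, a + D.K b i * r, ?_,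
        mul_ne_zero hk0 hvs, ?_, ?_⟩
      · intro x
        obtain ⟨g, hg, hg'⟩ := hsurj (x + β)
        exact ⟨g, by simp [hg, hg']⟩
      · intro g
        simp only [hXf, hYf]
        linear_combination - D.K (D.Y g) i * hβ
      · tauto

theorem HT_iff_good [Finite G] [NeZero d] [∀ i, Fact (p i).Prime] (h : Hol G) (q)
    (hv : D.Valid q) (hq : D.Rel h q) : HT h ↔ D.Good q := by
  constructor
  · intro hT
    have hb : IsUnit q.1 := by
      obtain ⟨g, -, hg⟩ := D.exE 0 1
      obtain ⟨m, rfl⟩ := hT g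
      rw [D.Y_pow h q hq] at hg
      exact IsUnit.of_mul_eq_one_right _ hg
    refine ⟨hb, fun i => ?_⟩
    obtain ⟨w, μ, ν, hw, hμ, H, hiff⟩ := D.exists_w h q hv hq hb i
    exact hiff.mp (nec h hT w hw μ ν hμ H)
  · rintro ⟨hb, hl⟩
    apply suf
    intro m hm
    apply D.hdvd
    · intro i
      obtain ⟨w, μ, ν, hw, hμ, H, hiff⟩ := D.exists_w h q hv hq hb i
      obtain ⟨hμ1, hν⟩ := hiff.mpr (hl i)
      subst hμ1
      have := transl h w ν (fun g => by rw [H, one_mul]) m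
      rw [hm] at this
      have h0 : (m : ZMod (p i)) * ν = 0 := by simpa using this.symm
      rw [← ZMod.natCast_eq_zero_iff]
      exact (mul_eq_zero.mp h0).resolve_right hν
    · have := D.Y_pow h q hq m
      rw [hm, D.Y1] at this
      rw [← ZMod.natCast_eq_zero_iff]
      exact (hb.mul_left_eq_zero).mp this.symm

theorem card_eq_good [Finite G] [NeZero d] [∀ i, Fact (p i).Prime] :
    Nat.card {h : Hol G // HT h} = Nat.card {q // D.Good q} := by
  choose Q hQv hQ using D.rel_ex
  refine Nat.card_congr (Equiv.ofBijective
    (fun h => ⟨Q h.1, (D.HT_iff_good h.1 _ (hQv _) (hQ _)).mp h.2⟩) ⟨?_, ?_⟩)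
  · intro h h' hh
    have hh' : Q h.1 = Q h'.1 := congrArg Subtype.val hh
    have := hQ h'.1
    rw [← hh'] at this
    exact Subtype.ext (D.rel_inj (hQ h.1) this)
  · rintro ⟨q, hg⟩
    obtain ⟨h, hh⟩ := D.rel_ex' q hg.valid
    refine ⟨⟨h, (D.HT_iff_good h q hg.valid hh).mpr hg⟩, Subtype.ext ?_⟩
    exact D.rel_inj' (hQv h) hg.valid (hQ h) hh

theorem card_local {P : ℕ} [Fact P.Prime] (t : ZMod P) (ht0 : t ≠ 0) (ht : t ≠ 1) :
    Nat.card {x : ZMod P × ZMod P × ZMod P //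
      (t * x.2.1 = 1 ∧ x.1 + t * x.2.2 ≠ 0) ∨ (x.2.1 = 1 ∧ x.2.2 ≠ 0)} = 2 * P * (P - 1) := by
  classical
  have cne : Nat.card {u : ZMod P // u ≠ 0} = P - 1 := by
    rw [Nat.card_eq_fintype_card, Fintype.card_subtype_compl, Fintype.card_subtype_eq, ZMod.card]
  have h1 : Nat.card {x : ZMod P × ZMod P × ZMod P //
      (t * x.2.1 = 1 ∧ x.1 + t * x.2.2 ≠ 0)} = P * (P - 1) := by
    have E : {x : ZMod P × ZMod P × ZMod P // (t * x.2.1 = 1 ∧ x.1 + t * x.2.2 ≠ 0)} ≃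
        ZMod P × {u : ZMod P // u ≠ 0} :=
      ⟨fun x => (x.1.2.2, ⟨x.1.1 + t * x.1.2.2, x.2.2⟩),
       fun y => ⟨(y.2.1 - t * y.1, t⁻¹, y.1), mul_inv_cancel₀ ht0, by simpa using y.2.2⟩,
       by
        rintro ⟨⟨a, s, r⟩, h1, h2⟩
        have : t⁻¹ = s := inv_eq_of_mul_eq_one_right h1
        simp [this],
       by
        rintro ⟨r, u, hu⟩
        simp⟩
    rw [Nat.card_congr E, Nat.card_prod, cne, Nat.card_zmod]
  have h2 : Nat.card {x : ZMod P × ZMod P × ZMod P // (x.2.1 = 1 ∧ x.2.2 ≠ 0)} = P * (P - 1) := by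
    have E : {x : ZMod P × ZMod P × ZMod P // (x.2.1 = 1 ∧ x.2.2 ≠ 0)} ≃
        ZMod P × {u : ZMod P // u ≠ 0} :=
      ⟨fun x => (x.1.1, ⟨x.1.2.2, x.2.2⟩),
       fun y => ⟨(y.1, 1, y.2.1), rfl, y.2.2⟩,
       by
        rintro ⟨⟨a, s, r⟩, h1, h2⟩
        simp only at h1
        subst h1
        rfl,
       fun _ => rfl⟩
    rw [Nat.card_congr E, Nat.card_prod, cne, Nat.card_zmod]
  rw [Nat.card_congr (subtypeOrEquiv _ _ ?_), Nat.card_sum, h1, h2]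
  · ring
  · rw [Pi.disjoint_iff]
    intro x
    rw [Prop.disjoint_iff]
    rintro ⟨⟨h, -⟩, ⟨h', -⟩⟩
    rw [h', mul_one] at h
    exact ht h

theorem card_LGood [NeZero d] [∀ i, Fact (p i).Prime] (b : ZMod d) (hb : IsUnit b) (i : ι) :
    Nat.card {t // D.LGood b i t} =
      (p i - 1) * (if D.K 1 i = 1 then 1 else 2 * p i) := by
  classical
  split_ifs with hk
  · have E : {t // D.LGood b i t} ≃ {u : ZMod (p i) // u ≠ 0} :=
      ⟨fun t => ⟨t.1.1, (t.2.resolve_right fun h => h.1 hk).2.1⟩,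
       fun u => ⟨(u.1, 1, 0), Or.inl ⟨hk, u.2, rfl, rfl⟩⟩,
       by
        rintro ⟨⟨a, s, r⟩, h⟩
        obtain ⟨-, -, h1, h2⟩ := h.resolve_right fun h => h.1 hk
        simp only at h1 h2
        subst h1 h2
        rfl,
       fun _ => rfl⟩
    rw [Nat.card_congr E, Nat.card_eq_fintype_card, Fintype.card_subtype_compl,
      Fintype.card_subtype_eq, ZMod.card, mul_one]
  · have hkb : D.K b i ≠ 1 := fun h => hk (D.K_one_of hb h 1)
    rw [mul_comm, ← card_local (D.K b i) (D.Kne b i) hkb]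
    refine Nat.card_congr (Equiv.subtypeEquivRight fun t => ?_)
    unfold LGood
    tauto

theorem card_good [Fintype ι] [NeZero d] [∀ i, Fact (p i).Prime] :
    Nat.card {q // D.Good q} =
      d.totient * ∏ i, ((p i - 1) * (if D.K 1 i = 1 then 1 else 2 * p i)) := by
  classical
  have E : {q // D.Good q} ≃ Σ b : {b : ZMod d // IsUnit b}, ∀ i, {t // D.LGood b.1 i t} :=
    ⟨fun q => ⟨⟨q.1.1, q.2.1⟩, fun i => ⟨q.1.2 i, q.2.2 i⟩⟩,
     fun x => ⟨(x.1.1, fun i => (x.2 i).1), x.1.2, fun i => (x.2 i).2⟩,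
     fun _ => rfl, fun _ => rfl⟩
  rw [Nat.card_congr E, Nat.card_sigma]
  rw [Finset.sum_congr rfl
    (g := fun _ => ∏ i, ((p i - 1) * (if D.K 1 i = 1 then 1 else 2 * p i)))]
  · rw [Finset.sum_const, smul_eq_mul, Finset.card_univ]
    congr 1
    rw [← ZMod.card_units_eq_totient]
    exact Fintype.card_congr ⟨fun b => b.2.unit, fun u => ⟨u, u.isUnit⟩,
      fun b => Subtype.ext rfl, fun u => Units.ext rfl⟩
  · rintro ⟨b, hb⟩ -
    rw [Nat.card_pi]
    exact Finset.prod_congr rfl fun i _ => D.card_LGood b hb i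

end Coord

/-- The coordinates on `G(d,e,k)`. -/
theorem exists_coord (d e k : ℕ) (hd : 0 < d) (he : 0 < e)
    (hcop : Nat.Coprime d e) (hord : orderOf (k : ZMod e) = d)
    (hsf : Squarefree (d * e))
    (G : Type) [Group G] (σ τ : G)
    (hσ : orderOf σ = e) (hτ : orderOf τ = d)
    (hrel : τ * σ * τ⁻¹ = σ ^ k) (hgen : Subgroup.closure {σ, τ} = ⊤) :
    Nat.card G = d * e ∧
    ∃ D : Coord G e d (fun i : e.primeFactors => (i : ℕ)), D.K 1 = (k : ∀ i : e.primeFactors, ZMod i) := by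
  classical
  have : NeZero d := ⟨hd.ne'⟩
  have : NeZero e := ⟨he.ne'⟩
  have hsfe : Squarefree e := hsf.squarefree_of_dvd (dvd_mul_left _ _)
  have hprime : ∀ i : e.primeFactors, (i : ℕ).Prime := fun i => Nat.prime_of_mem_primeFactors i.2
  have hpe : ∀ i : e.primeFactors, (i : ℕ) ∣ e := fun i => Nat.dvd_of_mem_primeFactors i.2
  have hprod : ∏ i : e.primeFactors, (i : ℕ) = e := by
    rw [Finset.prod_coe_sort e.primeFactors (fun i => i)]
    exact Nat.prod_primeFactors_of_squarefree hsfe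
  have : ∀ i : e.primeFactors, NeZero (i : ℕ) := fun i => ⟨(hprime i).ne_zero⟩
  have hdvde : ∀ m : ℕ, (∀ i : e.primeFactors, (i : ℕ) ∣ m) → e ∣ m := by
    intro m hm
    by_cases hm0 : m = 0
    · simp [hm0]
    · rw [← Nat.prod_primeFactors_of_squarefree hsfe]
      refine (Finset.prod_dvd_prod_of_subset _ m.primeFactors _ ?_).trans
        (Nat.prod_primeFactors_dvd m)
      intro q hq
      exact Nat.mem_primeFactors.mpr ⟨Nat.prime_of_mem_primeFactors hq, hm ⟨q, hq⟩, hm0⟩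
  -- casts into R
  let Φ : ZMod e →+* (∀ i : e.primeFactors, ZMod i) :=
    RingHom.pi fun i => ZMod.castHom (hpe i) (ZMod i)
  have Φinj : Function.Injective Φ := by
    rw [injective_iff_map_eq_zero]
    intro a ha
    obtain ⟨n, rfl⟩ := ZMod.natCast_zmod_surjective a
    rw [map_natCast] at ha
    rw [ZMod.natCast_eq_zero_iff]
    apply hdvde
    intro i
    have := congrFun ha i
    rw [Pi.natCast_apply, Pi.zero_apply, ZMod.natCast_eq_zero_iff] at this
    exact this
  have cardR : Nat.card (∀ i : e.primeFactors, ZMod i) = e := by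
    rw [Nat.card_pi]
    simpa using hprod
  have Φbij : Function.Bijective Φ :=
    (Nat.bijective_iff_injective_and_card Φ).mpr ⟨Φinj, by rw [cardR, Nat.card_zmod]⟩
  have natR : ∀ x : ∀ i : e.primeFactors, ZMod i, ∃ n : ℕ, (n : ∀ i : e.primeFactors, ZMod i) = x := by
    intro x
    obtain ⟨a, rfl⟩ := Φbij.2 x
    obtain ⟨n, rfl⟩ := ZMod.natCast_zmod_surjective a
    exact ⟨n, (map_natCast Φ n).symm⟩
  have natR_eq : ∀ m n : ℕ, (m : ∀ i : e.primeFactors, ZMod i) = n ↔ σ ^ m = σ ^ n := by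
    intro m n
    rw [pow_eq_pow_iff_modEq, hσ, ← ZMod.natCast_eq_natCast_iff, ← map_natCast Φ, ← map_natCast Φ]
    exact Φinj.eq_iff
  have natD_eq : ∀ m n : ℕ, (m : ZMod d) = n ↔ τ ^ m = τ ^ n := by
    intro m n
    rw [pow_eq_pow_iff_modEq, hτ, ← ZMod.natCast_eq_natCast_iff]
  have ordk : orderOf (k : ∀ i : e.primeFactors, ZMod i) = d := by
    rw [← hord, ← map_natCast Φ]
    exact orderOf_injective Φ.toMonoidHom Φinj _
  -- relations in G
  have r1 : τ * σ = σ ^ k * τ := by rw [← hrel]; group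
  have r2 : ∀ x : ℕ, τ * σ ^ x = σ ^ (k * x) * τ := by
    intro x
    have : SemiconjBy τ σ (σ ^ k) := r1
    have := (this.pow_right x).eq
    rw [this, pow_mul]
  have r3 : ∀ y x : ℕ, τ ^ y * σ ^ x = σ ^ (k ^ y * x) * τ ^ y := by
    intro y
    induction y with
    | zero => simp
    | succ y ih =>
      intro x
      rw [pow_succ, mul_assoc, r2, ← mul_assoc, ih, mul_assoc]
      congr 2
      ring
  have mulf : ∀ x y x' y' : ℕ, (σ ^ x * τ ^ y) * (σ ^ x' * τ ^ y') =
      σ ^ (x + k ^ y * x') * τ ^ (y + y') := by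
    intro x y x' y'
    rw [pow_add, pow_add, mul_assoc, ← mul_assoc (τ ^ y), r3]
    simp only [mul_assoc]
  have surj : ∀ g : G, ∃ x y : ℕ, g = σ ^ x * τ ^ y := by
    intro g
    have hg : g ∈ Subgroup.closure {σ, τ} := by rw [hgen]; trivial
    have iσ : σ⁻¹ = σ ^ (e - 1) := by
      rw [inv_eq_iff_mul_eq_one, ← pow_succ', Nat.sub_add_cancel he, ← hσ, pow_orderOf_eq_one]
    have iτ : τ⁻¹ = τ ^ (d - 1) := by
      rw [inv_eq_iff_mul_eq_one, ← pow_succ', Nat.sub_add_cancel hd, ← hτ, pow_orderOf_eq_one]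
    have aux1 : ∀ (m : ℕ) (g : G), (∃ x y : ℕ, g = σ ^ x * τ ^ y) →
        ∃ x y : ℕ, σ ^ m * g = σ ^ x * τ ^ y := by
      rintro m _ ⟨x, y, rfl⟩
      exact ⟨m + x, y, by rw [pow_add, mul_assoc]⟩
    have aux2 : ∀ (m : ℕ) (g : G), (∃ x y : ℕ, g = σ ^ x * τ ^ y) →
        ∃ x y : ℕ, τ ^ m * g = σ ^ x * τ ^ y := by
      rintro m _ ⟨x, y, rfl⟩
      exact ⟨k ^ m * x, m + y, by rw [← mul_assoc, r3, pow_add, mul_assoc]⟩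
    induction hg using Subgroup.closure_induction_left with
    | one => exact ⟨0, 0, by simp⟩
    | mul_left x hx y hy ih =>
      rcases hx with rfl | rfl
      · simpa using aux1 1 y ih
      · simpa using aux2 1 y ih
    | inv_mul_cancel x hx y hy ih =>
      rcases hx with rfl | rfl
      · rw [iσ]; exact aux1 _ y ih
      · rw [iτ]; exact aux2 _ y ih
  have inj : ∀ x y x' y' : ℕ, σ ^ x * τ ^ y = σ ^ x' * τ ^ y' → σ ^ x = σ ^ x' ∧ τ ^ y = τ ^ y' := by
    intro x y x' y' h
    have h1 : (σ ^ x')⁻¹ * σ ^ x = τ ^ y' * (τ ^ y)⁻¹ := by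
      rw [inv_mul_eq_iff_eq_mul, ← mul_assoc, eq_mul_inv_iff_mul_eq, h]
    have hA : (σ ^ x')⁻¹ * σ ^ x ∈ Subgroup.zpowers σ :=
      mul_mem (inv_mem (Subgroup.npow_mem_zpowers _ _)) (Subgroup.npow_mem_zpowers _ _)
    have hB : (σ ^ x')⁻¹ * σ ^ x ∈ Subgroup.zpowers τ := by
      rw [h1]
      exact mul_mem (Subgroup.npow_mem_zpowers _ _) (inv_mem (Subgroup.npow_mem_zpowers _ _))
    have hA' : orderOf ((σ ^ x')⁻¹ * σ ^ x) ∣ e := hσ ▸ orderOf_dvd_of_mem_zpowers hA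
    have hB' : orderOf ((σ ^ x')⁻¹ * σ ^ x) ∣ d := hτ ▸ orderOf_dvd_of_mem_zpowers hB
    have h0 : (σ ^ x')⁻¹ * σ ^ x = 1 :=
      orderOf_eq_one_iff.mp (Nat.eq_one_of_dvd_coprimes hcop hB' hA')
    have h2 : σ ^ x = σ ^ x' := (inv_mul_eq_one.mp h0).symm
    refine ⟨h2, ?_⟩
    rw [h2] at h
    exact mul_left_cancel h
  choose x y hxy using surj
  have hx : ∀ m n : ℕ, (x (σ ^ m * τ ^ n) : ∀ i : e.primeFactors, ZMod i) = m := fun m n =>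
    (natR_eq _ _).mpr (inj _ _ _ _ (hxy (σ ^ m * τ ^ n))).1.symm
  have hy : ∀ m n : ℕ, (y (σ ^ m * τ ^ n) : ZMod d) = n := fun m n =>
    (natD_eq _ _).mpr (inj _ _ _ _ (hxy (σ ^ m * τ ^ n))).2.symm
  have Kval : ∀ n : ℕ, (k : ∀ i : e.primeFactors, ZMod i) ^ (n : ZMod d).val = (k : ∀ i : e.primeFactors, ZMod i) ^ n := by
    intro n
    rw [ZMod.val_natCast]
    conv_lhs => rw [← ordk]
    exact pow_mod_orderOf _ _
  have bij : Function.Bijective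
      (fun g => ((x g : ∀ i : e.primeFactors, ZMod i), (y g : ZMod d))) := by
    constructor
    · intro g h hgh
      have h1 := (natR_eq _ _).mp (congrArg Prod.fst hgh)
      have h2 := (natD_eq _ _).mp (congrArg Prod.snd hgh)
      rw [hxy g, hxy h, h1, h2]
    · rintro ⟨a, b⟩
      obtain ⟨m, rfl⟩ := natR a
      obtain ⟨n, rfl⟩ := ZMod.natCast_zmod_surjective b
      exact ⟨σ ^ m * τ ^ n, Prod.ext (hx m n) (hy m n)⟩
  have cardG : Nat.card G = d * e := by
    rw [Nat.card_congr (Equiv.ofBijective _ bij), Nat.card_prod, cardR, Nat.card_zmod, mul_comm]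
  refine ⟨cardG, ⟨fun g => x g, fun g => y g, fun b => (k : ∀ i : e.primeFactors, ZMod i) ^ b.val,
    ?_, ?_, ?_, ?_, ?_, bij, ?_, hcop.symm, ?_, ?_, ?_⟩, ?_⟩
  · intro g h
    have := mulf (x g) (y g) (x h) (y h)
    rw [← hxy g, ← hxy h] at this
    rw [this, hx, Kval]
    push_cast
    rfl
  · intro g h
    have := mulf (x g) (y g) (x h) (y h)
    rw [← hxy g, ← hxy h] at this
    rw [this, hy]
    push_cast
    rfl
  · intro a b
    obtain ⟨m, rfl⟩ := ZMod.natCast_zmod_surjective a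
    obtain ⟨n, rfl⟩ := ZMod.natCast_zmod_surjective b
    rw [← Nat.cast_add, Kval, Kval, Kval, pow_add]
  · simp
  · intro a b hab
    simp only at hab
    apply ZMod.val_injective d
    refine pow_injOn_Iio_orderOf (x := (k : ∀ i : e.primeFactors, ZMod i)) ?_ ?_ hab
    · rw [ordk]; exact ZMod.val_lt a
    · rw [ordk]; exact ZMod.val_lt b
  · ext i
    rw [Pi.natCast_apply, Pi.zero_apply, ZMod.natCast_eq_zero_iff]
    exact hpe i
  · intro a
    obtain ⟨n, rfl⟩ := natR a
    exact ⟨n, by simp⟩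
  · intro i
    exact (hcop.coprime_dvd_right (hpe i)).symm
  · intro m h1 h2
    rw [cardG]
    exact hcop.mul_dvd_of_dvd_of_dvd h2 (hdvde m h1)
  · have := Kval 1
    simpa using this

/-- The final arithmetic identity. -/
theorem final_arith (e k : ℕ) (he : 0 < e) (hk : 0 < k) (hsf : Squarefree e)
    (z g : ℕ) (hz : z = Nat.gcd e (k - 1)) (hg : g = e / z) :
    ∏ q ∈ e.primeFactors, ((q - 1) * (if (k : ZMod q) = 1 then 1 else 2 * q)) =
      e.totient * (2 ^ g.primeFactors.card * g) := by
  classical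
  have hze : z ∣ e := hz ▸ Nat.gcd_dvd_left _ _
  have hge : g * z = e := by rw [hg]; exact Nat.div_mul_cancel hze
  have hgd : g ∣ e := ⟨z, hge.symm⟩
  have hg0 : g ≠ 0 := by rintro rfl; omega
  have hgsf : Squarefree g := hsf.squarefree_of_dvd hgd
  have hcop : Nat.Coprime g z := Nat.coprime_of_squarefree_mul (hge ▸ hsf)
  have hfil : e.primeFactors.filter (fun q => ¬ (k : ZMod q) = 1) = g.primeFactors := by
    ext q
    simp only [Finset.mem_filter, Nat.mem_primeFactors]
    have key : ((k : ZMod q) = 1) ↔ q ∣ k - 1 := by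
      rw [← ZMod.natCast_eq_zero_iff, Nat.cast_sub hk, sub_eq_zero, Nat.cast_one]
    rw [key]
    constructor
    · rintro ⟨⟨hq, hqe, -⟩, hn⟩
      refine ⟨hq, ?_, hg0⟩
      rw [← hge] at hqe
      refine (hq.dvd_mul.mp hqe).resolve_right fun h => hn ?_
      rw [hz] at h
      exact h.trans (Nat.gcd_dvd_right _ _)
    · rintro ⟨hq, hqg, -⟩
      refine ⟨⟨hq, hqg.trans hgd, he.ne'⟩, fun h => ?_⟩
      have : q ∣ z := hz ▸ Nat.dvd_gcd (hqg.trans hgd) h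
      exact hq.one_lt.ne' (Nat.eq_one_of_dvd_coprimes hcop hqg this)
  rw [Finset.prod_mul_distrib]
  congr 1
  · rw [Nat.totient_eq_prod_factorization he.ne', Nat.prod_factorization_eq_prod_primeFactors]
    refine Finset.prod_congr rfl fun q hq => ?_
    have : e.factorization q = 1 :=
      Nat.factorization_eq_one_of_squarefree hsf (Nat.prime_of_mem_primeFactors hq)
        (Nat.dvd_of_mem_primeFactors hq)
    rw [this]; simp
  · rw [Finset.prod_ite, Finset.prod_const_one, one_mul, hfil, Finset.prod_mul_distrib,
      Finset.prod_const, Nat.prod_primeFactors_of_squarefree hgsf]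

/-- **Theorem (count of regular cyclic subgroups of the holomorph).** Let
`G = G(d,e,k)` of squarefree order `n = d·e`, with `z = gcd(e,k-1)` and `g = e/z`.
Then `Hol(G)` contains exactly `2^{ω(g)}·g` regular cyclic subgroups. -/
theorem count_regular_cyclic_subgroups (d e k : ℕ) (hd : 0 < d) (he : 0 < e) (hk : 0 < k)
    (hcop : Nat.Coprime d e) (hord : orderOf (k : ZMod e) = d)
    (hsf : Squarefree (d * e))
    (G : Type) [Group G] (σ τ : G)
    (hσ : orderOf σ = e) (hτ : orderOf τ = d)
    (hrel : τ * σ * τ⁻¹ = σ ^ k) (hgen : Subgroup.closure {σ, τ} = ⊤)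
    (z g : ℕ) (hz : z = Nat.gcd e (k - 1)) (hg : g = e / z) :
    Nat.card {C : Subgroup (Hol G) // IsCyclic C ∧ IsRegularHolSubgroup G C} =
      2 ^ g.primeFactors.card * g := by
  obtain ⟨hcard, D, hD⟩ := exists_coord d e k hd he hcop hord hsf G σ τ hσ hτ hrel hgen
  have : NeZero d := ⟨hd.ne'⟩
  have : ∀ i : e.primeFactors, Fact (i : ℕ).Prime :=
    fun i => ⟨Nat.prime_of_mem_primeFactors i.2⟩
  have : Finite G := Nat.finite_of_card_ne_zero (by rw [hcard]; positivity)
  have h1 := card_HT (G := G)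
  rw [D.card_eq_good, D.card_good, hD, hcard, Nat.totient_mul hcop] at h1
  simp only [Pi.natCast_apply] at h1
  rw [Finset.prod_coe_sort e.primeFactors
    (fun q => (q - 1) * (if (k : ZMod q) = 1 then 1 else 2 * q)),
    final_arith e k he hk (hsf.squarefree_of_dvd (dvd_mul_left _ _)) z g hz hg] at h1
  have hpos : 0 < d.totient * e.totient :=
    Nat.mul_pos (Nat.totient_pos.mpr hd) (Nat.totient_pos.mpr he)
  apply Nat.eq_of_mul_eq_mul_right hpos
  rw [← h1]
  ring
end

section
/- Let m be an odd squarefree positive integer, let n = 2m, and let Γ be a cyclic group of order n. Then the number of regular subgroups of Perm(Γ) that are isomorphic to the dihedral group of order 2m and normalized by the left-translation subgroup λ(Γ) is 2^{ω(m)}, where ω(m) is the number of distinct prime factors of m. (Equivalently, a cyclic Galois field extension of degree 2m admits exactly 2^{ω(m)} Hopf–Galois structures of dihedral type.) -/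
def DihEps {m : ℕ} : DihedralGroup m → ZMod 2
  | .r _ => 0
  | .sr _ => 1

lemma dihEps_mul {m : ℕ} (a b : DihedralGroup m) : DihEps (a * b) = DihEps a + DihEps b := by
  cases a <;> cases b <;> simp [DihEps]; decide

lemma dihEps_pow {m : ℕ} (hodd : Odd m) (d : DihedralGroup m) : DihEps d = 0 ↔ d ^ m = 1 := by
  cases d with
  | r i => 
    simp only [DihEps, true_iff]
    rw [DihedralGroup.r_pow]; simp
  | sr i =>
    obtain ⟨k, hk⟩ := hodd
    have h1 : (DihedralGroup.sr i) ^ m = DihedralGroup.sr i := by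
      have : (DihedralGroup.sr i) ^ 2 = 1 := by rw [pow_two]; simp
      rw [show (DihedralGroup.sr i) ^ m = (DihedralGroup.sr i) ^ (2 * k + 1) from congrArg _ hk]
      rw [pow_add, pow_mul, this]; simp
    rw [h1]
    rw [DihedralGroup.one_def]; simp [DihEps, -DihedralGroup.r_zero]

lemma eps_zero {m : ℕ} (d : DihedralGroup m) (h : DihEps d = 0) : ∃ k, d = .r k := by
  cases d with
  | r i => exact ⟨i, rfl⟩
  | sr i => simp [DihEps] at h

lemma eps_one {m : ℕ} (d : DihedralGroup m) (h : DihEps d = 1) : ∃ k, d = .sr k := by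
  cases d with
  | r i => simp [DihEps] at h
  | sr i => exact ⟨i, rfl⟩

abbrev PP (m : ℕ) := ZMod 2 × ZMod m

/-- weight -/
def wt {m : ℕ} (a : ZMod m) (e : ZMod 2) : ZMod m := if e = 0 then 1 else a

def stdFun {m : ℕ} (a : ZMod m) : DihedralGroup m → PP m → PP m
  | .r k, x => (x.1, x.2 + wt a x.1 * k)
  | .sr k, x => (x.1 + 1, -(a * (x.2 + wt a x.1 * k)))

lemma zmod2 (e : ZMod 2) : e = 0 ∨ e = 1 := by revert e; decide
lemma zmod2two : (1 : ZMod 2) + 1 = 0 := by decide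

lemma stdFun_mul {m : ℕ} (a : ZMod m) (ha : a * a = 1) (d d' : DihedralGroup m) (x : PP m) :
    stdFun a (d * d') x = stdFun a d (stdFun a d' x) := by
  obtain ⟨e, x⟩ := x
  cases d <;> cases d' <;> rcases zmod2 e with rfl | rfl <;>
    simp [stdFun, wt, zmod2two] <;> grind

lemma stdFun_one {m : ℕ} (a : ZMod m) (x : PP m) :
    stdFun a 1 x = x := by
  rw [DihedralGroup.one_def]; simp [stdFun, -DihedralGroup.r_zero]

def stdHom {m : ℕ} (a : ZMod m) (ha : a * a = 1) : DihedralGroup m →* Equiv.Perm (PP m) where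
  toFun d := ⟨stdFun a d, stdFun a d⁻¹,
    fun x => by rw [← stdFun_mul a ha]; simp [stdFun_one],
    fun x => by rw [← stdFun_mul a ha]; simp [stdFun_one]⟩
  map_one' := by ext1 x; simp [stdFun_one]
  map_mul' d d' := by ext1 x; simp [stdFun_mul a ha]

lemma stdHom_apply {m : ℕ} (a : ZMod m) (ha : a * a = 1) (d x) : stdHom a ha d x = stdFun a d x := rfl

lemma std_free {m : ℕ} (a : ZMod m) (ha : a * a = 1) (d x) (h : stdFun a d x = x) : d = 1 := by
  obtain ⟨e, x⟩ := x
  cases d with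
  | r k => 
    simp only [stdFun, Prod.mk.injEq, true_and, add_eq_left] at h
    rw [DihedralGroup.one_def]
    congr 1
    rcases zmod2 e with rfl | rfl <;> simp [wt] at h <;> grind
  | sr k => 
    rcases zmod2 e with rfl | rfl <;> simp [stdFun] at h

lemma std_trans {m : ℕ} (a : ZMod m) (ha : a * a = 1) (x y) : ∃ d, stdFun a d x = y := by
  obtain ⟨e, x⟩ := x
  obtain ⟨f, y⟩ := y
  rcases zmod2 e with rfl | rfl <;> rcases zmod2 f with rfl | rfl
  · exact ⟨.r (y - x), by simp [stdFun, wt]⟩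
  · exact ⟨.sr (-(a * y) - x), by simp [stdFun, wt]; grind⟩
  · exact ⟨.sr (-y - a * x), by simp [stdFun, wt, zmod2two]; grind⟩
  · exact ⟨.r (a * (y - x)), by simp [stdFun, wt]; grind⟩

lemma std_norm {m : ℕ} (a : ZMod m) (ha : a * a = 1) (γ : PP m) (d) :
    ∃ d', ∀ x, γ + stdFun a d x = stdFun a d' (γ + x) := by
  obtain ⟨e, c⟩ := γ
  cases d with
  | r k =>
    refine ⟨.r (wt a e * k), fun ⟨f, x⟩ => ?_⟩
    rcases zmod2 e with rfl | rfl <;> rcases zmod2 f with rfl | rfl <;>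
    simp [stdFun, wt, zmod2two] <;> grind
  | sr k =>
    refine ⟨.sr (wt a e * k - a * c - c), fun ⟨f, x⟩ => ?_⟩
    rcases zmod2 e with rfl | rfl <;> rcases zmod2 f with rfl | rfl <;>
    simp [stdFun, wt, zmod2two] <;> grind

lemma rad_zero {m : ℕ} [NeZero m] (hm : Squarefree m) (c : ZMod m) (h : ∀ z, IsUnit (1 + c * z)) :
    c = 0 := by
  have : IsReduced (ZMod m) := isReduced_zmod.2 (Or.inl hm)
  have h1 : c ∈ Ideal.jacobson (⊥ : Ideal (ZMod m)) := by
    rw [Ideal.mem_jacobson_bot]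
    intro y
    rw [add_comm]; exact h y
  have h2 : IsNilpotent (Ideal.jacobson (⊥ : Ideal (ZMod m))) := IsArtinianRing.isNilpotent_jacobson_bot
  obtain ⟨n, hn⟩ := h2
  have := Ideal.pow_mem_pow h1 n
  rw [hn] at this
  exact IsReduced.eq_zero c ⟨n, by simpa using this⟩

lemma count_sq {m : ℕ} (hm : Squarefree m) (hodd : Odd m) :
    Nat.card {a : ZMod m // a * a = 1} = 2 ^ m.primeFactors.card := by
  have hprod : ∏ p : m.primeFactors, (p : ℕ) = m := by
    rw [Finset.prod_coe_sort m.primeFactors (fun p => p)]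
    exact Nat.prod_primeFactors_of_squarefree hm
  have hco : Pairwise (Function.onFun Nat.Coprime (fun p : m.primeFactors => (p : ℕ))) := by
    intro p q hpq
    exact (Nat.coprime_primes (Nat.prime_of_mem_primeFactors p.2) (Nat.prime_of_mem_primeFactors q.2)).2
      (fun h => hpq (Subtype.ext h))
  have e0 := ZMod.prodEquivPi (fun p : m.primeFactors => (p : ℕ)) hco
  rw [hprod] at e0
  have e1 : {a : ZMod m // a * a = 1} ≃
      {f : (∀ p : m.primeFactors, ZMod p) // ∀ p, f p * f p = 1} :=
    e0.toEquiv.subtypeEquiv (fun a => by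
      rw [← e0.injective.eq_iff, map_mul, map_one, funext_iff]; rfl)
  rw [Nat.card_congr (e1.trans (Equiv.subtypePiEquivPi (p := fun {p} x => x * x = 1))), Nat.card_pi]
  rw [Finset.prod_congr rfl (g := fun _ => 2)]
  · simp
  intro p _
  have hp := Nat.prime_of_mem_primeFactors p.2
  have : Fact (p : ℕ).Prime := ⟨hp⟩
  have hp2 : (p : ℕ) ≠ 2 := by
    intro h
    have := Nat.dvd_of_mem_primeFactors p.2
    rw [h] at this
    exact (Nat.not_even_iff_odd.2 hodd) (even_iff_two_dvd.2 this)
  have h2 : (1 : ZMod p) ≠ -1 := by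
    have : Fact (2 < (p : ℕ)) := ⟨by have := hp.two_le; omega⟩
    exact (ZMod.neg_one_ne_one).symm
  have : {x : ZMod p | x * x = 1} = {1, -1} := by
    ext x; simp [mul_self_eq_one_iff]
  show Nat.card ({x : ZMod p | x * x = 1} : Set _) = 2
  rw [this, Nat.card_coe_set_eq, Set.ncard_pair h2]

set_option maxHeartbeats 1000000 in
lemma main_struct {m : ℕ} [NeZero m] (hm : Squarefree m) (hodd : Odd m)
    (ρ : DihedralGroup m →* Equiv.Perm (PP m))
    (hfree : ∀ d x, ρ d x = x → d = 1)
    (htrans : ∀ x y, ∃ d, ρ d x = y)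
    (hnorm : ∀ γ d, ∃ d', ∀ x, γ + ρ d x = ρ d' (γ + x)) :
    ∃ a : ZMod m, a * a = 1 ∧ ∀ d, ∃ d', ∀ x, stdFun a d x = ρ d' x := by
  have mulA : ∀ d d' x, ρ (d * d') x = ρ d (ρ d' x) := fun d d' x => by simp
  have oneA : ∀ x, ρ 1 x = x := fun x => by simp
  have inj : ∀ d d' x, ρ d x = ρ d' x → d = d' := by
    intro d d' x h
    have : d'⁻¹ * d = 1 := by
      apply hfree _ x
      rw [mulA, h, ← mulA]; simp
    exact (inv_mul_eq_one.1 this).symm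
  choose cj hcj using hnorm
  -- conjugation is multiplicative
  have cj_mul : ∀ γ d d', cj γ (d * d') = cj γ d * cj γ d' := by
    intro γ d d'
    apply inj _ _ (γ + 0)
    rw [← hcj, mulA, mulA, ← hcj, ← hcj]
  have cj_one : ∀ γ, cj γ 1 = 1 := by
    intro γ
    apply inj _ _ (γ + 0)
    rw [← hcj, oneA, oneA]
  have cj_pow : ∀ γ d (n : ℕ), cj γ (d ^ n) = cj γ d ^ n := by
    intro γ d n
    induction n with
    | zero => simp [cj_one]
    | succ n ih => rw [pow_succ, pow_succ, cj_mul, ih]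
  have cj_add : ∀ γ δ d, cj (γ + δ) d = cj γ (cj δ d) := by
    intro γ δ d
    apply inj _ _ (γ + δ + 0)
    rw [← hcj, add_assoc, add_assoc, hcj δ, hcj γ]
  have cj_zero : ∀ d, cj 0 d = d := by
    intro d
    apply inj _ _ (0 + 0)
    rw [← hcj]; simp
  have cj_inj : ∀ γ d, cj γ d = 1 → d = 1 := by
    intro γ d h
    rw [← cj_zero d, ← neg_add_cancel γ, cj_add, h, cj_one]
  have cj_eps : ∀ γ d, DihEps (cj γ d) = DihEps d := by
    intro γ d
    have : DihEps (cj γ d) = 0 ↔ DihEps d = 0 := by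
      rw [dihEps_pow hodd, dihEps_pow hodd, ← cj_pow]
      exact ⟨cj_inj _ _, fun h => by rw [h, cj_one]⟩
    rcases zmod2 (DihEps d) with h | h <;> rcases zmod2 (DihEps (cj γ d)) with hq | hq
    · rw [h, hq]
    · rw [this.2 h, h]
    · rw [this.1 hq, hq]
    · rw [h, hq]
  -- coordinates
  choose D hD using fun x => htrans 0 x
  have Dρ : ∀ d x, D (ρ d x) = d * D x := by
    intro d x
    apply inj _ _ 0
    rw [hD, mulA, hD]
  have Dadd : ∀ γ x, D (γ + x) = cj γ (D x) * D γ := by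
    intro γ x
    apply inj _ _ 0
    rw [hD, mulA, hD]
    conv_lhs => rw [← hD x, hcj, add_zero]
  let E : PP m →+ ZMod 2 := AddMonoidHom.mk' (fun x => DihEps (D x)) (by
    intro γ x
    simp only [Dadd, dihEps_mul, cj_eps]
    rw [add_comm])
  have hE : ∀ x, E x = DihEps (D x) := fun x => rfl
  have E0 : ∀ y : ZMod m, E (0, y) = 0 := by
    intro y
    have h1 : m • ((0, y) : PP m) = 0 := by ext <;> simp
    have h2 := congrArg E h1
    rw [map_nsmul, map_zero] at h2
    rcases zmod2 (E (0, y)) with h | h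
    · exact h
    · rw [h] at h2
      rw [nsmul_eq_mul, mul_one, ZMod.natCast_eq_zero_iff] at h2
      exact absurd (even_iff_two_dvd.2 h2) (Nat.not_even_iff_odd.2 hodd)
  have E1 : E (1, 0) = 1 := by
    rcases zmod2 (E (1, 0)) with h | h
    · exfalso
      have hall : ∀ x, E x = 0 := by
        rintro ⟨e, y⟩
        have : ((e, y) : PP m) = (e, 0) + (0, y) := by simp
        rw [this, map_add, E0, add_zero]
        rcases zmod2 e with rfl | rfl
        · exact E0 0
        · exact h
      have h3 := hall (ρ (.sr 0) 0)
      rw [hE, Dρ, dihEps_mul, ← hE, hall] at h3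
      simp [DihEps] at h3
    · exact h
  have Efst : ∀ x, E x = x.1 := by
    rintro ⟨e, y⟩
    have : ((e, y) : PP m) = (e, 0) + (0, y) := by simp
    rw [this, map_add, E0, add_zero]
    rcases zmod2 e with rfl | rfl
    · simp [E0 0]
    · simp [E1]
  have fstρ : ∀ d x, (ρ d x).1 = DihEps d + x.1 := by
    intro d x
    rw [← Efst, ← Efst, hE, hE, Dρ, dihEps_mul]
  -- the character
  have hχ : ∀ γ, ∃ b : ZMod m, ∀ k, cj γ (.r k) = .r (b * k) := by
    intro γ
    obtain ⟨b, hb⟩ := eps_zero _ (cj_eps γ (.r 1))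
    refine ⟨b, fun k => ?_⟩
    have := cj_pow γ (.r 1) k.val
    rw [hb] at this
    simpa using this
  choose χ hχ using hχ
  have rinj : ∀ i j : ZMod m, (DihedralGroup.r i) = .r j → i = j := fun i j h => by simpa using h
  have χadd : ∀ γ δ, χ (γ + δ) = χ γ * χ δ := by
    intro γ δ
    have := cj_add γ δ (.r 1)
    rw [hχ, hχ, hχ] at this
    simpa using this
  have χ0 : χ 0 = 1 := by
    have := cj_zero (.r 1)
    rw [hχ] at this
    simpa using this
  have χunit : ∀ γ, IsUnit (χ γ) := by
    intro γ
    refine IsUnit.of_mul_eq_one (χ (-γ)) ?_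
    rw [← χadd, add_neg_cancel, χ0]
  -- the cocycle
  have hG : ∀ y : ZMod m, ∃ k, D (0, y) = .r k := fun y => eps_zero _ (E0 y)
  choose G hG using hG
  have Gadd : ∀ x y, G (y + x) = χ (0, y) * G x + G y := by
    intro x y
    have := Dadd (0, y) (0, x)
    rw [hG, hχ, hG, Prod.mk_add_mk, zero_add, hG] at this
    simpa using this
  have Gsurj : ∀ z, ∃ x, G x = z := by
    intro z
    have h1 : (ρ (.r z) 0).1 = 0 := by rw [fstρ]; simp [DihEps]
    refine ⟨(ρ (.r z) 0).2, ?_⟩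
    have h2 : ((0, (ρ (.r z) 0).2) : PP m) = ρ (.r z) 0 := by
      rw [← h1]
    have h3 := hG (ρ (.r z) 0).2
    rw [h2] at h3
    apply rinj
    rw [← h3]
    apply inj _ _ 0
    rw [hD]
  obtain ⟨x1, hx1⟩ := Gsurj 1
  have hc : χ (0, x1) - 1 = 0 := by
    apply rad_zero hm
    intro z
    obtain ⟨y, hy⟩ := Gsurj z
    have e1 := Gadd x1 y
    have e2 := Gadd y x1
    rw [add_comm, e2, hx1, hy] at e1
    have : 1 + (χ (0, x1) - 1) * z = χ (0, y) := by linear_combination e1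
    rw [this]; exact χunit _
  have χ1 : ∀ y, χ (0, y) = 1 := by
    intro y
    have e1 := Gadd x1 y
    have e2 := Gadd y x1
    rw [add_comm, e2, hx1] at e1
    linear_combination (G y) * hc - e1
  -- rotations are translations on each half
  have comm : ∀ y k x, (0, y) + ρ (.r k) x = ρ (.r k) ((0, y) + x) := by
    intro y k x
    rw [hcj, hχ, χ1, one_mul]
  obtain ⟨u, hu⟩ : ∃ u, ρ (.r 1) 0 = (0, u) := ⟨(ρ (.r 1) 0).2, by
    apply Prod.ext
    · rw [fstρ]; simp [DihEps]
    · rfl⟩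
  set c := χ (1, 0) with hcdef
  have hcc : c * c = 1 := by
    rw [hcdef, ← χadd, Prod.mk_add_mk, zmod2two, zero_add]; exact χ0
  have r0 : ∀ k : ZMod m, ρ (.r k) 0 = (0, u * k) := by
    have : ∀ n : ℕ, ρ (.r n) 0 = (0, u * n) := by
      intro n
      induction n with
      | zero => simp; rfl
      | succ n ih =>
        have : (DihedralGroup.r ((n + 1 : ℕ) : ZMod m)) = .r (n : ZMod m) * .r 1 := by simp
        rw [this, mulA, hu]
        have := comm u n 0
        rw [add_zero] at this
        rw [← this, ih]
        ext <;> simp; ring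
    intro k
    have := this k.val
    simpa using this
  have ru : ∀ k x, ρ (.r k) (0, x) = (0, x + u * k) := by
    intro k x
    have := comm x k 0
    rw [add_zero] at this
    rw [← this, r0]; simp
  have rv : ∀ k x, ρ (.r k) (1, x) = (1, x + u * (c * k)) := by
    intro k x
    have h1 := hcj (1, 0) (.r (c * k)) (0, x)
    rw [hχ, ← hcdef, ← mul_assoc, hcc, one_mul, ru] at h1
    simpa using h1.symm
  -- `u` is a unit
  obtain ⟨w, hw⟩ : ∃ w, u * w = 1 := by
    have h1 := hD (0, 1)
    rw [hG, r0] at h1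
    exact ⟨G 1, by simpa using h1⟩
  -- the reflection
  obtain ⟨i, hi⟩ := eps_one (D (1, 0)) E1
  have T0 := hD (1, 0)
  rw [hi] at T0
  have Ta : ∀ x, ρ (.sr i) (0, x) = (1, -(c * x)) := by
    intro x
    have h1 : ((0, x) : PP m) = ρ (.r (w * x)) 0 := by
      rw [r0, ← mul_assoc, hw, one_mul]
    have h2 : (DihedralGroup.sr i) * .r (w * x) = .r (-(w * x)) * .sr i := by simp
    rw [h1, ← mulA, h2, mulA, T0, rv]
    ext
    · rfl
    · simp only []
      linear_combination (-c * x) * hw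
  have Tb : ∀ x, ρ (.sr i) (1, x) = (0, -(c * x)) := by
    intro x
    have h1 : ((1, x) : PP m) = ρ (.sr i) (0, -(c * x)) := by
      rw [Ta]
      ext
      · rfl
      · simp only []
        linear_combination (-x) * hcc
    rw [h1, ← mulA]; simp
  have Tx : ∀ e x, ρ (.sr i) (e, x) = (e + 1, -(c * x)) := by
    intro e x
    rcases zmod2 e with rfl | rfl
    · rw [Ta]; simp
    · rw [Tb, zmod2two]
  have Rx : ∀ k e x, ρ (.r (w * k)) (e, x) = (e, x + wt c e * k) := by
    intro k e x
    rcases zmod2 e with rfl | rfl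
    · rw [ru, ← mul_assoc, hw]; simp [wt]
    · rw [rv]
      ext
      · rfl
      · simp only [wt, one_ne_zero, if_false]
        linear_combination (c * k) * hw
  refine ⟨c, hcc, ?_⟩
  rintro (k | k)
  · exact ⟨.r (w * k), fun ⟨e, x⟩ => (Rx k e x).symm⟩
  · refine ⟨.sr i * .r (w * k), fun ⟨e, x⟩ => ?_⟩
    rw [mulA, Rx, Tx]; rfl

/-- the predicate on the additive side -/
def GoodSub (m : ℕ) (N : Subgroup (Equiv.Perm (PP m))) : Prop :=
  Nonempty (N ≃* DihedralGroup m) ∧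
    ((∀ x y, ∃ ν ∈ N, ν x = y) ∧ ∀ ν ∈ N, ∀ x, ν x = x → ν = 1) ∧
    ∀ γ : PP m, ∀ ν ∈ N, Equiv.addLeft γ * ν * (Equiv.addLeft γ)⁻¹ ∈ N

lemma stdHom_inj {m : ℕ} (a : ZMod m) (ha : a * a = 1) : Function.Injective (stdHom a ha) := by
  rw [injective_iff_map_eq_one]
  intro d hd
  apply std_free a ha d 0
  rw [← stdHom_apply a ha, hd]; rfl

lemma std_good {m : ℕ} (a : ZMod m) (ha : a * a = 1) : GoodSub m (stdHom a ha).range := by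
  refine ⟨⟨(MonoidHom.ofInjective (stdHom_inj a ha)).symm⟩, ⟨?_, ?_⟩, ?_⟩
  · intro x y
    obtain ⟨d, hd⟩ := std_trans a ha x y
    exact ⟨_, ⟨d, rfl⟩, hd⟩
  · rintro _ ⟨d, rfl⟩ x hx
    rw [std_free a ha d x hx, map_one]
  · rintro γ _ ⟨d, rfl⟩
    obtain ⟨d', hd'⟩ := std_norm a ha γ d
    refine ⟨d', ?_⟩
    rw [eq_mul_inv_iff_mul_eq]
    ext1 x
    exact (hd' x).symm

lemma count_add {m : ℕ} (hm : Squarefree m) (hodd : Odd m) :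
    Nat.card {N // GoodSub m N} = 2 ^ m.primeFactors.card := by
  have : NeZero m := ⟨hm.ne_zero⟩
  rw [← count_sq hm hodd]
  symm
  refine Nat.card_congr (Equiv.ofBijective
    (fun a : {a : ZMod m // a * a = 1} => (⟨(stdHom a.1 a.2).range, std_good a.1 a.2⟩ : {N // GoodSub m N}))
    ⟨?_, ?_⟩)
  · rintro ⟨a, ha⟩ ⟨b, hb⟩ h
    simp only [Subtype.mk.injEq] at h ⊢
    have h1 : stdHom a ha (.r 1) ∈ (stdHom b hb).range := by rw [← h]; exact ⟨_, rfl⟩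
    obtain ⟨d, hd⟩ := h1
    have h0 := DFunLike.congr_fun hd (0, 0)
    have h2 := DFunLike.congr_fun hd (1, 0)
    cases d with
    | r k =>
      simp only [stdHom_apply, stdFun, wt, Prod.mk.injEq] at h0 h2
      have hk : k = 1 := by simpa using h0
      subst hk
      symm; simpa using h2
    | sr k => simp [stdHom_apply, stdFun] at h0
  · rintro ⟨N, hN⟩
    obtain ⟨⟨φ⟩, ⟨ht, hf⟩, hn⟩ := hN
    let ρ : DihedralGroup m →* Equiv.Perm (PP m) := N.subtype.comp φ.symm.toMonoidHom
    have hρ : ∀ d, ρ d ∈ N := fun d => (φ.symm d).2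
    have hρs : ∀ ν ∈ N, ∃ d, ρ d = ν := fun ν h => ⟨φ ⟨ν, h⟩, by simp [ρ]⟩
    have hρi : ∀ d, ρ d = 1 → d = 1 := fun d h => by
      have : φ.symm d = 1 := Subtype.ext h
      simpa using this
    obtain ⟨a, ha, h⟩ := main_struct hm hodd ρ
      (fun d x h => hρi d (hf _ (hρ d) x h))
      (fun x y => by
        obtain ⟨ν, hν, h⟩ := ht x y
        obtain ⟨d, rfl⟩ := hρs ν hν
        exact ⟨d, h⟩)
      (fun γ d => by
        obtain ⟨d', hd'⟩ := hρs _ (hn γ _ (hρ d))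
        refine ⟨d', fun x => ?_⟩
        rw [hd']; simp)
    refine ⟨⟨a, ha⟩, Subtype.ext ?_⟩
    have hle : (stdHom a ha).range ≤ N := by
      rintro _ ⟨d, rfl⟩
      obtain ⟨d', hd'⟩ := h d
      have : stdHom a ha d = ρ d' := by ext1 x; exact hd' x
      rw [this]; exact hρ d'
    apply le_antisymm hle
    intro ν hν
    obtain ⟨d, hd⟩ := std_trans a ha 0 (ν 0)
    have h1 : stdHom a ha d ∈ N := hle ⟨d, rfl⟩
    have h2 := hf (ν⁻¹ * stdHom a ha d) (N.mul_mem (N.inv_mem hν) h1) 0 (by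
      rw [Equiv.Perm.mul_apply, stdHom_apply, hd]; simp)
    exact ⟨d, (inv_mul_eq_one.1 h2).symm⟩

/-- **Dihedral Hopf–Galois structures.** Let `m` be odd and squarefree, `n = 2m`, and
`Γ` cyclic of order `n`. Then the number of regular subgroups of `Perm Γ` isomorphic
to the dihedral group of order `2m` and normalised by left translations (equivalently,
the number of Hopf–Galois structures of dihedral type on a cyclic extension of degree
`2m`) is `2^{ω(m)}`. -/
theorem dihedral_hgs_count (m : ℕ) (hm : Squarefree m) (hodd : Odd m)
    (Γ : Type) [Group Γ] [IsCyclic Γ] (hΓ : Nat.card Γ = 2 * m) :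
    Nat.card {N : Subgroup (Equiv.Perm Γ) //
        Nonempty (N ≃* DihedralGroup m) ∧ IsRegularSubgroup Γ N ∧
          IsNormalizedByLeftTranslations Γ N} =
      2 ^ m.primeFactors.card := by
  have hco : Nat.Coprime 2 m := hodd.coprime_two_left
  let e1 : Γ ≃* Multiplicative (ZMod (2 * m)) := mulEquivOfCyclicCardEq (by
    rw [hΓ]; exact ((Nat.card_congr Multiplicative.toAdd).trans (Nat.card_zmod _)).symm)
  let e : Γ ≃ PP m := (e1.toEquiv.trans Multiplicative.toAdd).trans (ZMod.chineseRemainder hco).toEquiv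
  have he : ∀ x y, e (x * y) = e x + e y := fun x y => by simp [e]
  rw [← count_add hm hodd]
  refine Nat.card_congr (e.permCongrHom.mapSubgroup.toEquiv.subtypeEquiv fun N => ?_)
  have hmem : ∀ ν, e.permCongrHom ν ∈ e.permCongrHom.mapSubgroup N ↔ ν ∈ N := fun ν => by
    simp [MulEquiv.mapSubgroup]
  have hsurj : ∀ ν', ∃ ν, e.permCongrHom ν = ν' := e.permCongrHom.surjective
  have happ : ∀ ν x, e.permCongrHom ν (e x) = e (ν x) := fun ν x => by
    simp [Equiv.permCongrHom_coe]
  have hleft : ∀ γ, e.permCongrHom (Equiv.mulLeft γ) = Equiv.addLeft (e γ) := fun γ => by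
    ext1 x
    obtain ⟨x, rfl⟩ := e.surjective x
    rw [happ]; simp [he]
  refine and_congr ⟨?_, ?_⟩ (and_congr (and_congr ?_ ?_) ?_)
  · rintro ⟨f⟩
    exact ⟨(e.permCongrHom.subgroupMap N).symm.trans f⟩
  · rintro ⟨f⟩
    exact ⟨(e.permCongrHom.subgroupMap N).trans f⟩
  · rw [e.forall_congr_left]
    constructor
    · intro h x y
      obtain ⟨ν, hν, h⟩ := h x (e.symm y)
      exact ⟨e.permCongrHom ν, (hmem ν).2 hν, by
        rw [← e.apply_symm_apply x, happ, h]; simp⟩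
    · intro h x y
      obtain ⟨ν', hν, h⟩ := h x (e y)
      obtain ⟨ν, rfl⟩ := hsurj ν'
      refine ⟨ν, (hmem ν).1 hν, ?_⟩
      rw [← e.apply_symm_apply x, happ] at h
      exact e.injective h
  · constructor
    · intro h ν' hν x hx
      obtain ⟨ν, rfl⟩ := hsurj ν'
      obtain ⟨x, rfl⟩ := e.surjective x
      rw [happ] at hx
      rw [h ν ((hmem ν).1 hν) x (e.injective hx), map_one]
    · intro h ν hν x hx
      have := h _ ((hmem ν).2 hν) (e x) (by rw [happ, hx])
      exact e.permCongrHom.injective (by rw [this, map_one])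
  · constructor
    · intro h γ ν' hν
      obtain ⟨ν, rfl⟩ := hsurj ν'
      obtain ⟨γ, rfl⟩ := e.surjective γ
      have := (hmem _).2 (h γ ν ((hmem ν).1 hν))
      rw [map_mul, map_mul, map_inv, hleft] at this
      exact this
    · intro h γ ν hν
      have := h (e γ) _ ((hmem ν).2 hν)
      rw [← hleft, ← map_inv, ← map_mul, ← map_mul] at this
      exact (hmem _).1 this
end
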